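/- Assume M is a finitely generated unmixed R-module of dimension at least 2. If N(M) ≤ f_0(q, M) for some C-parameter ideal q of M, then M is Cohen-Macaulay. -/

import Mathlib

/-! Preliminary definitions: lengths, dimensions, (C-)systems of parameters, Hilbert
coefficients, irreducible multiplicities, local cohomology invariants, stable values,
unmixedness, the unmixed component, and the g-invariant. -/

open CategoryTheory CategoryTheory.Limits Opposite IsLocalRing

universe u

noncomputable section

section Definitions

variable (R : Type u) [CommRing R]

/-- The length of an `R`-module, defined as the Krull dimension of its submodule lattice. -/
def moduleLength (M : Type u) [AddCommGroup M] [Module R M] : WithBot ℕ∞ :=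
  Order.krullDim (Submodule R M)

/-- The Krull dimension of an `R`-module `M`, i.e. `dim (R / Ann M)`. -/
def moduleDim (M : Type u) [AddCommGroup M] [Module R M] : WithBot ℕ∞ :=
  ringKrullDim (R ⧸ Module.annihilator R M)

/-- The colon submodule `(N :_M I) = {x : M | I • x ⊆ N}`. -/
def modColon {M : Type u} [AddCommGroup M] [Module R M] (N : Submodule R M) (I : Ideal R) :
    Submodule R M where
  carrier := {x | ∀ r ∈ I, r • x ∈ N}
  add_mem' := by
    intro a b ha hb r hr
    simpa [smul_add] using N.add_mem (ha r hr) (hb r hr)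
  zero_mem' := by
    intro r hr
    simpa using N.zero_mem
  smul_mem' := by
    intro c a ha r hr
    rw [smul_comm]
    exact N.smul_mem c (ha r hr)

/-- `x : Fin s → R` is a system of parameters of the module `M`:
`s = dim M`, the `x i` are nonunits, and `M/(x)M` has finite length. -/
def IsSOP (M : Type u) [AddCommGroup M] [Module R M] {s : ℕ} (x : Fin s → R) : Prop :=
  moduleDim R M = (s : WithBot ℕ∞) ∧ (∀ i, x i ∈ nonunits R) ∧
    IsFiniteLength R (M ⧸ (Ideal.span (Set.range x) • (⊤ : Submodule R M)))

/-- The ideal `b(M)`: the intersection, over all systems of parameters `x` of `M` and all `i`,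
of `Ann_R ((0) :_{M/(x_1,...,x_{i-1})M} x_i)`. -/
def bIdeal (M : Type u) [AddCommGroup M] [Module R M] : Ideal R :=
  ⨅ (s : ℕ) (x : Fin s → R) (_ : IsSOP R M x) (i : Fin s),
    (Submodule.torsionBy R
      (M ⧸ (Ideal.span (x '' {j | j < i}) • (⊤ : Submodule R M))) (x i)).annihilator

/-- `x` is a C-system of parameters of `M`: a system of parameters such that
`x i ∈ b(M/(x_{i+1},...,x_s)M)^3` for every `i` (for `i = s` the quotient is `M` itself). -/
def IsCSOP (M : Type u) [AddCommGroup M] [Module R M] {s : ℕ} (x : Fin s → R) : Prop :=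
  IsSOP R M x ∧ ∀ i : Fin s,
    x i ∈ (bIdeal R (M ⧸ (Ideal.span (x '' {j | i < j}) • (⊤ : Submodule R M)))) ^ 3

/-- A parameter ideal of `R`. -/
def IsParamIdeal (q : Ideal R) : Prop :=
  ∃ (s : ℕ) (x : Fin s → R), IsSOP R R x ∧ q = Ideal.span (Set.range x)

/-- A C-parameter ideal of `R`: an ideal generated by a C-system of parameters of `R`. -/
def IsCParamIdeal (q : Ideal R) : Prop :=
  ∃ (s : ℕ) (x : Fin s → R), IsCSOP R R x ∧ q = Ideal.span (Set.range x)

/-- A C-parameter ideal of a module `M`. -/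
def IsCParamIdealMod (M : Type u) [AddCommGroup M] [Module R M] (q : Ideal R) : Prop :=
  ∃ (s : ℕ) (x : Fin s → R), IsCSOP R M x ∧ q = Ideal.span (Set.range x)

/-- `e` is the family of Hilbert coefficients of `M` (of dimension `s`) with respect to `I`:
`ℓ(M/I^{n+1}M) = ∑_{i=0}^{s} (-1)^i (e i) binom(n+s-i, s-i)` for all large `n`. -/
def IsHilbCoeffMod (I : Ideal R) (M : Type u) [AddCommGroup M] [Module R M] (s : ℕ)
    (e : ℕ → ℤ) : Prop :=
  ∃ N : ℕ, ∀ n ≥ N, ∃ L : ℕ,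
    moduleLength R (M ⧸ (I ^ (n + 1) • (⊤ : Submodule R M))) = (L : WithBot ℕ∞) ∧
    (L : ℤ) = ∑ i ∈ Finset.range (s + 1),
      (-1) ^ i * e i * ((n + s - i).choose (s - i) : ℤ)

/-- `e` is the family of Hilbert coefficients of `R` (of dimension `d`) with respect to `I`;
`e 1` is the Chern number of `I`. -/
def IsHilbCoeff (I : Ideal R) (d : ℕ) (e : ℕ → ℤ) : Prop :=
  IsHilbCoeffMod R I R d e

variable [IsLocalRing R]

/-- The colon ideal `(q :_R m)`. -/
def colonIdeal (q : Ideal R) : Ideal R :=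
  modColon R q (maximalIdeal R)

/-- The index of reducibility `ir_M(q) = ℓ((qM :_M m)/qM)`. -/
def irMod (M : Type u) [AddCommGroup M] [Module R M] (q : Ideal R) : WithBot ℕ∞ :=
  moduleLength R
    ↥(Submodule.map (q • (⊤ : Submodule R M)).mkQ
      (modColon R (q • (⊤ : Submodule R M)) (maximalIdeal R)))

/-- `NN` is the stable value `𝒩(M)` of `M`: the common index of reducibility of all
C-parameter ideals of `M`. -/
def IsStableValueMod (M : Type u) [AddCommGroup M] [Module R M] (NN : ℕ) : Prop :=
  ∀ q : Ideal R, IsCParamIdealMod R M q → irMod R M q = (NN : WithBot ℕ∞)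

/-- `NN` is the stable value `𝒩(R)` of `R`. -/
def IsStableValue (NN : ℕ) : Prop :=
  ∀ q : Ideal R, IsCParamIdeal R q → irMod R R q = (NN : WithBot ℕ∞)

/-- `f` is the family of coefficients of the polynomial giving the index of reducibility,
`ir_M(I^{n+1}) = ℓ((I^{n+1}M :_M m)/I^{n+1}M) = ∑_{i=0}^{s-1} (-1)^i (f i) binom(n+s-1-i, s-1-i)`
for all large `n`; `f 0` is the irreducible multiplicity of `M` with respect to `I`. -/
def IsIrrCoeffMod (I : Ideal R) (M : Type u) [AddCommGroup M] [Module R M] (s : ℕ)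
    (f : ℕ → ℤ) : Prop :=
  ∃ N : ℕ, ∀ n ≥ N, ∃ L : ℕ,
    irMod R M (I ^ (n + 1)) = (L : WithBot ℕ∞) ∧
    (L : ℤ) = ∑ i ∈ Finset.range s,
      (-1) ^ i * f i * ((n + s - 1 - i).choose (s - 1 - i) : ℤ)

/-- Ring version of `IsIrrCoeffMod`. -/
def IsIrrCoeff (I : Ideal R) (d : ℕ) (f : ℕ → ℤ) : Prop :=
  IsIrrCoeffMod R I R d f

/-- The local cohomology module `H^i_m(M)`. -/
def Hmod (M : Type u) [AddCommGroup M] [Module R M] (i : ℕ) : ModuleCat.{u} R :=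
  (localCohomology (maximalIdeal R) i).obj (ModuleCat.of R M)

/-- `r_i(M) = ℓ((0) :_{H^i_m(M)} m)`, the length of the socle of `H^i_m(M)`. -/
def rLengthMod (M : Type u) [AddCommGroup M] [Module R M] (i : ℕ) : WithBot ℕ∞ :=
  moduleLength R ↥(Submodule.torsionBySet R ↥(Hmod R M i) ((maximalIdeal R : Ideal R) : Set R))

/-- `r_i(R)`. -/
def rLength (i : ℕ) : WithBot ℕ∞ := rLengthMod R R i

/-- `M` is a Cohen-Macaulay `R`-module: `H^i_m(M) = 0` for all `i < dim M`. -/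
def IsCMMod (M : Type u) [AddCommGroup M] [Module R M] : Prop :=
  ∀ i : ℕ, (i : WithBot ℕ∞) < moduleDim R M → Subsingleton ↥(Hmod R M i)

/-- `R` is a Cohen-Macaulay local ring: `H^i_m(R) = 0` for all `i < dim R`. -/
def IsCMLocal : Prop :=
  ∀ i : ℕ, (i : WithBot ℕ∞) < ringKrullDim R → Subsingleton ↥(Hmod R R i)

/-- `R` is a generalized Cohen-Macaulay local ring:
`H^i_m(R)` has finite length for all `i < dim R`. -/
def IsGeneralizedCM : Prop :=
  ∀ i : ℕ, (i : WithBot ℕ∞) < ringKrullDim R → IsFiniteLength R ↥(Hmod R R i)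

/-- `R` is a Gorenstein local ring: Cohen-Macaulay of type `r_d(R) = 1`, `d = dim R`. -/
def IsGorensteinLocal : Prop :=
  IsCMLocal R ∧ ∀ d : ℕ, ringKrullDim R = (d : WithBot ℕ∞) → rLength R d = (1 : WithBot ℕ∞)

/-- `R` is unmixed: `dim R̂/p = dim R̂` for every associated prime `p` of the
`m`-adic completion `R̂` of `R`. -/
def IsUnmixedRing : Prop :=
  ∀ p ∈ associatedPrimes (AdicCompletion (maximalIdeal R) R) (AdicCompletion (maximalIdeal R) R),
    ringKrullDim ((AdicCompletion (maximalIdeal R) R) ⧸ p) =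
      ringKrullDim (AdicCompletion (maximalIdeal R) R)

/-- `M` is unmixed: `dim R̂/p = dim M̂` for every associated prime `p` of the
`m`-adic completion `M̂` of `M`, viewed over `R̂`. -/
def IsUnmixedMod (M : Type u) [AddCommGroup M] [Module R M] : Prop :=
  ∀ p ∈ associatedPrimes (AdicCompletion (maximalIdeal R) R) (AdicCompletion (maximalIdeal R) M),
    ringKrullDim ((AdicCompletion (maximalIdeal R) R) ⧸ p) =
      moduleDim (AdicCompletion (maximalIdeal R) R) (AdicCompletion (maximalIdeal R) M)

/-- `H^0_m(M)`, described as the submodule of elements killed by a power of `m`. -/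
def H0Sub (M : Type u) [AddCommGroup M] [Module R M] : Submodule R M :=
  ⨆ n : ℕ, Submodule.torsionBySet R M (((maximalIdeal R) ^ n : Ideal R) : Set R)

/-- The unmixed component `u = U_R(0)` of `R`: the largest ideal of dimension `< dim R`. -/
def unmixedComponent : Ideal R := sSup {J : Ideal R | moduleDim R ↥J < ringKrullDim R}

end Definitions

section CMImage

/-- `R` is a homomorphic image of a Cohen-Macaulay (Noetherian) local ring. -/
def IsHomImageOfCM (R : Type u) [CommRing R] : Prop :=
  ∃ (A : Type u) (_ : CommRing A) (_ : IsLocalRing A) (_ : IsNoetherianRing A),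
    IsCMLocal A ∧ ∃ f : A →+* R, Function.Surjective f

end CMImage

section GInvariant

variable (R : Type u) [CommRing R] [IsLocalRing R] [IsNoetherianRing R]

/-- The canonical homomorphism from `Ext^p(R/q, R)` (the term of the directed system indexed by
the ideal `q` with `J ≤ rad q`) into the local cohomology module `H^p_J(R)`, given by the
structure of `H^p_J(R)` as an inductive limit. -/
def canonicalToLocalCohomology (J q : Ideal R) (h : J ≤ q.radical) (p : ℕ) :
    ((localCohomology.diagram (localCohomology.selfLERadicalDiagram J) p).obj
        (op (⟨q, h⟩ : localCohomology.SelfLERadical J))).obj (ModuleCat.of R R) ⟶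
      (localCohomology J p).obj (ModuleCat.of R R) :=
  haveI := localCohomology.hasColimitDiagram.{u, u} (localCohomology.selfLERadicalDiagram J) p
  (colimit.ι (localCohomology.diagram (localCohomology.selfLERadicalDiagram J) p)
      (op (⟨q, h⟩ : localCohomology.SelfLERadical J))).app (ModuleCat.of R R) ≫
    (localCohomology.isoSelfLERadical J p).hom.app (ModuleCat.of R R)

/-- A map of `R`-modules is surjective on socles. -/
def SurjectiveOnSocles {A B : ModuleCat.{u} R} (φ : A ⟶ B) : Prop :=
  ∀ y ∈ Submodule.torsionBySet R ↥B ((maximalIdeal R : Ideal R) : Set R),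
    ∃ z ∈ Submodule.torsionBySet R ↥A ((maximalIdeal R : Ideal R) : Set R), φ z = y

/-- The defining property of the g-invariant: for every system of parameters `x` of `R`
contained in `m^(n₀)` and every `p`, the canonical homomorphism into the local cohomology
module `H^p_m(R)` is surjective on the socles. -/
def GProperty (n₀ : ℕ) : Prop :=
  ∀ (s : ℕ) (x : Fin s → R), IsSOP R R x → (∀ i, x i ∈ maximalIdeal R ^ n₀) →
    ∀ (h : maximalIdeal R ≤ (Ideal.span (Set.range x)).radical) (p : ℕ),
      SurjectiveOnSocles R
        (canonicalToLocalCohomology R (maximalIdeal R) (Ideal.span (Set.range x)) h p)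

/-- The g-invariant `g(R)`: the least `n₀` satisfying `GProperty`. -/
def gInvariant : ℕ := sInf {n₀ : ℕ | GProperty R n₀}

end GInvariant

end

theorem CategoryTheory.ProjectiveResolution.exactAt_linearYonedaObj_of_subsingleton_ext
    {R : Type u} [CommRing R] {X : ModuleCat.{u} R}
    (P : ProjectiveResolution X) (Y : ModuleCat.{u} R) (i : ℕ)
    (h : Subsingleton (Abelian.Ext X Y i)) :
    (P.complex.linearYonedaObj R Y).ExactAt i := by
  cases i with
  | zero =>
    rw [HomologicalComplex.exactAt_iff' _ 0 0 1 (by simp) (by simp),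
      ShortComplex.moduleCat_exact_iff]
    intro f hf
    have hf' : P.complex.d 1 0 ≫ (f : P.complex.X 0 ⟶ Y) = 0 := hf
    have hXY : Subsingleton (X ⟶ Y) := Abelian.Ext.addEquiv₀.symm.subsingleton
    obtain ⟨g, hg⟩ : ∃ g : ((ChainComplex.single₀ _).obj X).X 0 ⟶ Y, P.π.f 0 ≫ g = f :=
      ⟨P.exact₀.desc (f : P.complex.X 0 ⟶ Y) hf', P.exact₀.g_desc _ _⟩
    have hg0 : g = 0 := hXY.elim _ _
    refine ⟨0, ?_⟩
    rw [map_zero]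
    change (0 : P.complex.X 0 ⟶ Y) = f
    rw [← hg, hg0, comp_zero]
  | succ p =>
    rw [HomologicalComplex.exactAt_iff' _ p (p + 1) (p + 2) (by simp) (by simp),
      ShortComplex.moduleCat_exact_iff]
    intro f hf
    have hf' : P.complex.d (p + 2) (p + 1) ≫ (f : P.complex.X (p + 1) ⟶ Y) = 0 := hf
    obtain ⟨g, hg⟩ := (P.extMk_eq_zero_iff _ (p + 2) rfl hf' p rfl).mp (Subsingleton.elim _ _)
    exact ⟨g, hg⟩

theorem isZero_Ext_of_subsingleton_ext {R : Type u} [CommRing R] (X Y : ModuleCat.{u} R) (i : ℕ)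
    (h : Subsingleton (Abelian.Ext X Y i)) :
    IsZero (((Ext R (ModuleCat.{u} R) i).obj (op X)).obj Y) := by
  let P := projectiveResolution X
  refine IsZero.of_iso ?_ (P.isoExt i Y)
  rw [← HomologicalComplex.exactAt_iff_isZero_homology]
  exact P.exactAt_linearYonedaObj_of_subsingleton_ext Y i h

theorem subsingleton_localCohomology {R : Type u} [CommRing R] (J : Ideal R) (i : ℕ)
    (Y : ModuleCat.{u} R)
    (h : ∀ t : ℕ, Subsingleton (Abelian.Ext (ModuleCat.of R (R ⧸ J ^ t)) Y i)) :
    Subsingleton ↥((localCohomology J i).obj Y) := by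
  have := localCohomology.hasColimitDiagram.{u, 0} (localCohomology.idealPowersDiagram J) i
  have e := colimitObjIsoColimitCompEvaluation
    (localCohomology.diagram (localCohomology.idealPowersDiagram J) i) Y
  have hz : IsZero (localCohomology.diagram (localCohomology.idealPowersDiagram J) i ⋙
      (evaluation _ _).obj Y) := by
    rw [Functor.isZero_iff]
    intro t
    exact isZero_Ext_of_subsingleton_ext _ _ _ (h t.unop.unop)
  have hz2 : IsZero ((localCohomology J i).obj Y) := by
    refine IsZero.of_iso ?_ e
    exact (colimit.isColimit _).isZero_pt hz
  exact ModuleCat.subsingleton_of_isZero hz2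

theorem isCMMod_of_isRegular {R : Type u} [CommRing R] [IsLocalRing R] [IsNoetherianRing R]
    (M : Type u) [AddCommGroup M] [Module R M] [Module.Finite R M] (rs : List R)
    (mem : ∀ r ∈ rs, r ∈ maximalIdeal R) (reg : RingTheory.Sequence.IsRegular M rs)
    (hdim : moduleDim R M = (rs.length : WithBot ℕ∞)) : IsCMMod R M := by
  intro i hi
  rw [hdim] at hi
  have hi : i < rs.length := by exact_mod_cast hi
  have : Nontrivial M := reg.nontrivial
  refine subsingleton_localCohomology _ _ _ fun t => ?_
  refine ModuleCat.subsingleton_ext_of_exists_isRegular (maximalIdeal R) _ ?_ (ModuleCat.of R M)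
    ?_ rs mem reg i hi
  · change Module.support R (R ⧸ maximalIdeal R ^ t) ⊆ _
    rw [Module.support_eq_zeroLocus, Ideal.annihilator_quotient,
      PrimeSpectrum.zeroLocus_subset_zeroLocus_iff]
    exact fun a ha => ⟨t, Ideal.pow_mem_pow ha t⟩
  · refine lt_top_iff_ne_top.mpr fun h => ?_
    exact top_ne_bot (α := Submodule R M) (Submodule.eq_bot_of_le_smul_of_le_jacobson_bot
      (maximalIdeal R) _ (Module.Finite.fg_top) h.ge (maximalIdeal_le_jacobson _))

/-- The length of `(A + B) / A`. -/
noncomputable def relLength {R M : Type*} [CommRing R] [AddCommGroup M] [Module R M]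
    (A B : Submodule R M) : ℕ∞ :=
  Module.length R (B.map A.mkQ)

section relLength

variable {R M N : Type*} [CommRing R] [AddCommGroup M] [Module R M] [AddCommGroup N] [Module R N]

theorem relLength_mono_right (A : Submodule R M) {B C : Submodule R M} (h : B ≤ C) :
    relLength A B ≤ relLength A C :=
  Module.length_le_of_injective (Submodule.inclusion (Submodule.map_mono h))
    (Submodule.inclusion_injective _)

theorem relLength_anti_left {A A' : Submodule R M} (h : A ≤ A') (B : Submodule R M) :
    relLength A' B ≤ relLength A B := by
  have : B.map A'.mkQ = (B.map A.mkQ).map (Submodule.factor h) := by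
    rw [← Submodule.map_comp]; rfl
  unfold relLength
  rw [this]
  exact Module.length_le_of_surjective ((Submodule.factor h).submoduleMap (B.map A.mkQ))
    (LinearMap.submoduleMap_surjective _ _)

theorem relLength_top (A : Submodule R M) : relLength A ⊤ = Module.length R (M ⧸ A) := by
  unfold relLength
  rw [Submodule.map_top, Submodule.range_mkQ]
  exact Module.length_top

theorem relLength_eq_zero_of_le {A B : Submodule R M} (h : B ≤ A) : relLength A B = 0 := by
  have : B.map A.mkQ = ⊥ := by
    rw [eq_bot_iff, Submodule.map_le_iff_le_comap, Submodule.comap_bot, Submodule.ker_mkQ]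
    exact h
  unfold relLength
  rw [this]
  exact Module.length_bot

theorem relLength_sup (A B : Submodule R M) : relLength A (A ⊔ B) = relLength A B := by
  unfold relLength
  rw [Submodule.map_sup, Submodule.mkQ_map_self, bot_sup_eq]

theorem relLength_comap (f : M →ₗ[R] N) (A : Submodule R N) (B : Submodule R M) :
    relLength (A.comap f) B = relLength A (B.map f) := by
  have key : (B.map (A.comap f).mkQ).map (Submodule.mapQ (A.comap f) A f le_rfl)
      = (B.map f).map A.mkQ := by
    rw [← Submodule.map_comp, ← Submodule.map_comp, Submodule.mapQ_mkQ]
  have hinj : Function.Injective (Submodule.mapQ (A.comap f) A f le_rfl) := by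
    rw [← LinearMap.ker_eq_bot, Submodule.ker_mapQ]
    simp
  unfold relLength
  rw [← key]
  exact (Submodule.equivMapOfInjective _ hinj _).length_eq

theorem relLength_eq_add {A B C : Submodule R M} (h : A ≤ B) (h' : B ≤ C) :
    relLength A C = relLength A B + relLength B C := by
  unfold relLength
  refine Module.length_eq_add_of_exact
    (Submodule.inclusion (Submodule.map_mono h'))
    (((Submodule.factor h).restrict (p := C.map A.mkQ) (q := C.map B.mkQ) ?_))
    (Submodule.inclusion_injective _) ?_ ?_
  · rintro _ ⟨c, hc, rfl⟩
    exact ⟨c, hc, rfl⟩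
  · rintro ⟨_, ⟨c, hc, rfl⟩⟩
    exact ⟨⟨A.mkQ c, ⟨c, hc, rfl⟩⟩, rfl⟩
  · rintro ⟨_, ⟨c, hc, rfl⟩⟩
    constructor
    · intro h0
      have h1 : B.mkQ c = 0 := congrArg Subtype.val h0
      refine ⟨⟨A.mkQ c, ⟨c, by simpa using h1, rfl⟩⟩, rfl⟩
    · rintro ⟨⟨_, ⟨b, hb, rfl⟩⟩, hbc⟩
      have h1 : A.mkQ b = A.mkQ c := congrArg Subtype.val hbc
      have h2 : B.mkQ b = B.mkQ c := congrArg (Submodule.factor h) h1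
      apply Subtype.ext
      change B.mkQ c = 0
      rw [← h2]; simpa using hb

theorem relLength_inf_left (A B : Submodule R M) : relLength (A ⊓ B) B = relLength A B := by
  have h1 := relLength_comap B.subtype A ⊤
  have h2 := relLength_comap B.subtype (A ⊓ B) ⊤
  have h3 : (A ⊓ B).comap B.subtype = A.comap B.subtype := by
    ext z; simp
  rw [h3, h1] at h2
  simpa using h2.symm

end relLength

section Monomial

variable {R M σ : Type*} [CommRing R] [AddCommGroup M] [Module R M] [Fintype σ]

/-- The monomial `x ^ α`. -/
def monomialEval (x : σ → R) (α : σ →₀ ℕ) : R := ∏ i, x i ^ α i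

theorem monomialEval_add (x : σ → R) (α β : σ →₀ ℕ) :
    monomialEval x (α + β) = monomialEval x α * monomialEval x β := by
  simp [monomialEval, pow_add, Finset.prod_mul_distrib]

theorem monomialEval_single (x : σ → R) (i : σ) (n : ℕ) :
    monomialEval x (Finsupp.single i n) = x i ^ n := by
  classical
  rw [monomialEval, Finset.prod_eq_single i]
  · simp
  · intro j _ hj
    simp [Finsupp.single_eq_of_ne hj]
  · simp

theorem monomialEval_mem_pow (x : σ → R) (α : σ →₀ ℕ) :
    monomialEval x α ∈ Ideal.span (Set.range x) ^ α.degree := by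
  rw [Finsupp.degree_eq_sum, ← Finset.prod_pow_eq_pow_sum]
  exact Ideal.prod_mem_prod fun i _ =>
    Ideal.pow_mem_pow (Ideal.subset_span (Set.mem_range_self i)) _

theorem span_range_pow_le (x : σ → R) (n : ℕ) :
    Ideal.span (Set.range x) ^ n ≤ Ideal.span (monomialEval x '' {β | n ≤ β.degree}) := by
  induction n with
  | zero =>
    refine fun r _ => ?_
    have : (1 : R) ∈ Ideal.span (monomialEval x '' {β | 0 ≤ β.degree}) :=
      Ideal.subset_span ⟨0, by simp, by simp [monomialEval]⟩
    rw [(Ideal.eq_top_iff_one _).mpr this]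
    trivial
  | succ n ih =>
    rw [pow_succ]
    refine (Ideal.mul_mono_left ih).trans ?_
    rw [Ideal.span_mul_span', Ideal.span_le]
    rintro _ ⟨_, ⟨β, hβ, rfl⟩, _, ⟨i, rfl⟩, rfl⟩
    refine Ideal.subset_span ⟨β + Finsupp.single i 1, ?_, ?_⟩
    · simpa using hβ
    · simp [monomialEval_add, monomialEval_single]

theorem relLength_inf_le (f : M →ₗ[R] M) (A W : Submodule R M) :
    relLength (W ⊓ A) (W ⊓ (A ⊔ LinearMap.range f)) ≤
      relLength (A.comap f) ((W ⊔ A).comap f) := by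
  have h1 : relLength (W ⊓ A) (W ⊓ (A ⊔ LinearMap.range f)) =
      relLength A (W ⊓ (A ⊔ LinearMap.range f)) := by
    rw [← relLength_inf_left A]
    congr 1
    rw [← inf_assoc, inf_comm A W, inf_assoc]
    congr 1
    exact (inf_eq_left.mpr le_sup_left).symm
  rw [h1, relLength_comap, ← relLength_sup A (Submodule.map _ _)]
  refine relLength_mono_right _ ?_
  rintro w ⟨hw, hw'⟩
  obtain ⟨a, ha, _, ⟨z, rfl⟩, rfl⟩ := Submodule.mem_sup.mp hw'
  refine Submodule.add_mem_sup ha ⟨z, ?_, rfl⟩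
  change f z ∈ W ⊔ A
  have : f z = (a + f z) + (-a) := by abel
  rw [this]
  exact Submodule.add_mem_sup hw (neg_mem ha)

variable [LinearOrder σ]

theorem relLength_monomial_le (x : σ → R) (L W : Submodule R M) (S : Finset (σ →₀ ℕ))
    (c : (σ →₀ ℕ) → ℕ∞)
    (hc : ∀ α ∈ S, relLength
      ((Ideal.span (monomialEval x '' {β | β ∉ S ∨ toDegLex α < toDegLex β}) • ⊤ ⊔ L).comap
        (LinearMap.lsmul R M (monomialEval x α)))
      ((W ⊔ (Ideal.span (monomialEval x '' {β | β ∉ S ∨ toDegLex α < toDegLex β}) • ⊤ ⊔ L)).comap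
        (LinearMap.lsmul R M (monomialEval x α))) ≤ c α) :
    relLength (W ⊓ (Ideal.span (monomialEval x '' {β | β ∉ S}) • ⊤ ⊔ L)) W ≤
      ∑ α ∈ S, c α := by
  classical
  revert hc
  refine Finset.induction_on_max_value (fun α => toDegLex α) S ?_ ?_
  · intro _
    have : (Ideal.span (monomialEval x '' {β | β ∉ (∅ : Finset (σ →₀ ℕ))})) = ⊤ :=
      (Ideal.eq_top_iff_one _).mpr (Ideal.subset_span ⟨0, by simp, by simp [monomialEval]⟩)
    rw [this]
    simp only [Submodule.top_smul, top_sup_eq, inf_top_eq, Finset.sum_empty]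
    exact (relLength_eq_zero_of_le le_rfl).le
  · intro a s ha hmax ih hc
    have hlt : ∀ α ∈ s, toDegLex α < toDegLex a := fun α hα =>
      lt_of_le_of_ne (hmax α hα) fun h => ha (by rwa [← toDegLex.injective h])
    have ih := ih fun α hα => by
      have hset : {β | β ∉ s ∨ toDegLex α < toDegLex β} =
          {β | β ∉ insert a s ∨ toDegLex α < toDegLex β} := by
        ext β
        by_cases hβ : β = a
        · subst hβ
          simp [ha, hlt α hα]
        · simp [hβ]
      rw [hset]
      exact hc α (Finset.mem_insert_of_mem hα)
    have hset : {β | β ∉ insert a s ∨ toDegLex a < toDegLex β} = {β | β ∉ insert a s} := by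
      ext β
      simp only [Set.mem_ofPred_eq, or_iff_left_iff_imp]
      intro h hβ
      rcases Finset.mem_insert.mp hβ with rfl | hβ
      · exact lt_irrefl _ h
      · exact lt_asymm h (hlt β hβ)
    have ha' := hc a (Finset.mem_insert_self _ _)
    rw [hset] at ha'
    set A := Ideal.span (monomialEval x '' {β | β ∉ insert a s}) • (⊤ : Submodule R M) ⊔ L
    have hB : Ideal.span (monomialEval x '' {β | β ∉ s}) • (⊤ : Submodule R M) ⊔ L =
        A ⊔ LinearMap.range (LinearMap.lsmul R M (monomialEval x a)) := by
      have h1 : {β | β ∉ s} = {β | β ∉ insert a s} ∪ {a} := by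
        ext β
        by_cases hβ : β = a
        · subst hβ; simp [ha]
        · simp [hβ]
      rw [h1, Set.image_union, Ideal.span_union, Submodule.sup_smul, Set.image_singleton]
      have h2 : Ideal.span {monomialEval x a} • (⊤ : Submodule R M) =
          LinearMap.range (LinearMap.lsmul R M (monomialEval x a)) := by
        ext z
        simp [Submodule.ideal_span_singleton_smul, Submodule.mem_smul_pointwise_iff_exists]
      rw [h2, sup_right_comm]
    rw [hB] at ih
    rw [Finset.sum_insert ha,
      relLength_eq_add (B := W ⊓ (A ⊔ LinearMap.range (LinearMap.lsmul R M (monomialEval x a))))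
        (inf_le_inf_left _ le_sup_left) inf_le_left]
    exact add_le_add ((relLength_inf_le _ _ _).trans ha') ih

end Monomial

theorem toDegLex_lt_add_single {σ : Type*} [LinearOrder σ] (α : σ →₀ ℕ) (i : σ) :
    toDegLex α < toDegLex (α + Finsupp.single i 1) := by
  rw [Finsupp.DegLex.lt_iff]
  left
  simp

section InitColon

variable {R σ : Type*} [CommRing R] [Fintype σ] [LinearOrder σ]

/-- The submodule of those `z` such that `x ^ α z` is a combination of larger monomials. -/
def initColon (x : σ → R) (M : Type*) [AddCommGroup M] [Module R M] (α : σ →₀ ℕ) :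
    Submodule R M :=
  (Ideal.span (monomialEval x '' {β | toDegLex α < toDegLex β}) • (⊤ : Submodule R M)).comap
    (LinearMap.lsmul R M (monomialEval x α))

theorem monomialEval_smul_mem (x : σ → R) {M : Type*} [AddCommGroup M] [Module R M]
    {α : σ →₀ ℕ} (γ : σ →₀ ℕ) {z : M}
    (hz : z ∈ Ideal.span (monomialEval x '' {β | toDegLex α < toDegLex β}) •
      (⊤ : Submodule R M)) :
    monomialEval x γ • z ∈
      Ideal.span (monomialEval x '' {β | toDegLex (α + γ) < toDegLex β}) •
        (⊤ : Submodule R M) := by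
  have h := Submodule.smul_mem_smul (Ideal.mem_span_singleton_self (monomialEval x γ)) hz
  rw [← Submodule.mul_smul, Ideal.span_mul_span'] at h
  refine Submodule.smul_mono_left (Ideal.span_mono ?_) h
  rintro _ ⟨_, rfl, _, ⟨β, hβ, rfl⟩, rfl⟩
  refine ⟨β + γ, ?_, ?_⟩
  · exact add_lt_add_left (α := DegLex (σ →₀ ℕ)) hβ (toDegLex γ)
  · change monomialEval x (β + γ) = monomialEval x γ * monomialEval x β
    rw [monomialEval_add, mul_comm]

variable (x : σ → R) (M : Type*) [AddCommGroup M] [Module R M]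

theorem initColon_mono : Monotone (initColon x M) := by
  intro α β h z hz
  obtain ⟨γ, rfl⟩ := le_iff_exists_add.mp h
  have := monomialEval_smul_mem x γ hz
  rw [initColon, Submodule.mem_comap, LinearMap.lsmul_apply]
  rw [monomialEval_add, mul_comm, mul_smul]
  exact this

theorem smul_top_le_initColon (α : σ →₀ ℕ) :
    Ideal.span (Set.range x) • ⊤ ≤ initColon x M α := by
  rw [initColon, ← Submodule.map_le_iff_le_comap, Submodule.map_smul'']
  have hle : (⊤ : Submodule R M).map (LinearMap.lsmul R M (monomialEval x α)) ≤
      Ideal.span {monomialEval x α} • ⊤ := by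
    rintro _ ⟨z, _, rfl⟩
    exact Submodule.smul_mem_smul (Ideal.mem_span_singleton_self _) trivial
  refine (Submodule.smul_mono le_rfl hle).trans ?_
  rw [← Submodule.mul_smul, Ideal.span_mul_span']
  refine Submodule.smul_mono_left (Ideal.span_mono ?_)
  rintro _ ⟨_, ⟨i, rfl⟩, _, rfl, rfl⟩
  refine ⟨α + Finsupp.single i 1, toDegLex_lt_add_single _ _, ?_⟩
  rw [monomialEval_add, monomialEval_single, pow_one]
  exact mul_comm _ _

theorem mem_initColon_of_smul_mem {l : σ} {α : σ →₀ ℕ} (hα : α l ≠ 0) {z : M}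
    (hz : x l • z ∈ Ideal.span (x '' {j | j < l}) • (⊤ : Submodule R M)) :
    z ∈ initColon x M α := by
  obtain ⟨γ, rfl⟩ : ∃ γ, α = γ + Finsupp.single l 1 :=
    ⟨α - Finsupp.single l 1, by
      rw [tsub_add_cancel_of_le]; simpa [Nat.one_le_iff_ne_zero] using hα⟩
  rw [initColon, Submodule.mem_comap, LinearMap.lsmul_apply]
  rw [monomialEval_add, monomialEval_single, pow_one, mul_smul]
  have h := Submodule.smul_mem_smul (Ideal.mem_span_singleton_self (monomialEval x γ)) hz
  rw [← Submodule.mul_smul, Ideal.span_mul_span'] at h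
  refine Submodule.smul_mono_left (Ideal.span_mono ?_) h
  rintro _ ⟨_, rfl, _, ⟨j, hj, rfl⟩, rfl⟩
  refine ⟨γ + Finsupp.single j 1, ?_, ?_⟩
  · exact add_lt_add_right (α := DegLex (σ →₀ ℕ)) (Finsupp.DegLex.single_lt_iff.mpr hj)
      (toDegLex γ)
  · change _ = monomialEval x γ * x j
    rw [monomialEval_add, monomialEval_single, pow_one]

theorem exists_initColon_eq [IsNoetherian R M] :
    ∃ α₀, ∀ α, α₀ ≤ α → initColon x M α = initColon x M α₀ := by
  obtain ⟨_, ⟨α₀, rfl⟩, h⟩ := WellFounded.has_min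
    (wellFounded_gt : WellFounded ((· > ·) : Submodule R M → Submodule R M → Prop))
    (Set.range (initColon x M)) ⟨_, 0, rfl⟩
  refine ⟨α₀, fun α hα => ?_⟩
  by_contra hne
  exact h _ ⟨α, rfl⟩ (lt_of_le_of_ne (initColon_mono x M hα) (Ne.symm hne))

theorem finite_initColon_ne [IsNoetherian R M] :
    {α : σ →₀ ℕ | ∀ i, initColon x M α ≠ initColon x M (α + Finsupp.single i 1)}.Finite := by
  by_contra hinf
  let f := Set.Infinite.natEmbedding _ hinf
  obtain ⟨g, hg⟩ := (wellQuasiOrdered_le (α := σ →₀ ℕ)).exists_monotone_subseq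
    (fun n => ((f n : _) : σ →₀ ℕ))
  let K : ℕ →o Submodule R M :=
    ⟨fun n => initColon x M (f (g n)), fun m n h => initColon_mono x M (hg m n h)⟩
  obtain ⟨n, hn⟩ := monotone_stabilizes_iff_noetherian.mpr ‹IsNoetherian R M› K
  have hlt : ((f (g n) : _) : σ →₀ ℕ) < f (g (n + 1)) := by
    refine lt_of_le_of_ne (hg _ _ n.le_succ) fun h => ?_
    have := g.injective (f.injective (Subtype.ext h))
    omega
  obtain ⟨i, hi⟩ : ∃ i, (f (g n) : σ →₀ ℕ) i < (f (g (n + 1)) : σ →₀ ℕ) i := by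
    by_contra! h
    exact hlt.not_ge h
  refine (f (g n)).2 i (le_antisymm (initColon_mono x M le_self_add) ?_)
  have h1 : initColon x M (f (g n)) = initColon x M (f (g (n + 1))) := hn (n + 1) n.le_succ
  rw [h1]
  refine initColon_mono x M ?_
  intro j
  by_cases hj : j = i
  · subst hj; simpa using hi
  · simpa [Finsupp.single_eq_of_ne hj] using hlt.le j

end InitColon

section Bounds

theorem pow_smul_top_le {R M σ : Type*} [CommRing R] [AddCommGroup M] [Module R M] [Fintype σ]
    [LinearOrder σ] (x : σ → R) {n : ℕ} {α : σ →₀ ℕ} (h : α.degree ≤ n) :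
    Ideal.span (Set.range x) ^ (n + 1) • (⊤ : Submodule R M) ≤
      Ideal.span (monomialEval x '' {β | toDegLex α < toDegLex β}) • ⊤ := by
  refine Submodule.smul_mono_left ((span_range_pow_le x (n + 1)).trans (Ideal.span_mono ?_))
  refine Set.image_mono fun β hβ => ?_
  change toDegLex α < toDegLex β
  rw [Finsupp.DegLex.lt_iff]
  exact Or.inl (lt_of_le_of_lt h hβ)

theorem relLength_pow_colon_le {R M : Type u} {σ : Type*} [CommRing R] [AddCommGroup M]
    [Module R M] [Fintype σ] [LinearOrder σ] (x : σ → R) (𝔪 : Ideal R)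
    (hx : ∀ i, x i ∈ 𝔪) (n : ℕ) (B : Finset (σ →₀ ℕ))
    (hB : ∀ α, (∀ i, initColon x M α ≠ initColon x M (α + Finsupp.single i 1)) → α ∈ B) :
    relLength (Ideal.span (Set.range x) ^ (n + 1) • (⊤ : Submodule R M))
        (modColon R (Ideal.span (Set.range x) ^ (n + 1) • (⊤ : Submodule R M)) 𝔪) ≤
      B.card * Module.length R (M ⧸ (Ideal.span (Set.range x) • (⊤ : Submodule R M))) +
      ∑ α ∈ Finset.univ.finsuppAntidiag n,
        relLength (initColon x M α) (modColon R (initColon x M α) 𝔪) := by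
  classical
  set L := Ideal.span (Set.range x) ^ (n + 1) • (⊤ : Submodule R M) with hL
  set W := modColon R L 𝔪
  have hLW : L ≤ W := fun z hz r _ => L.smul_mem r hz
  let S : Finset (σ →₀ ℕ) := (Finset.range (n + 1)).biUnion fun k => Finset.univ.finsuppAntidiag k
  have hS : ∀ α, α ∈ S ↔ α.degree ≤ n := fun α => by
    simp [S, Finsupp.degree_eq_sum]
  let c₁ : (σ →₀ ℕ) → ℕ∞ := fun α =>
    if α ∈ B then Module.length R (M ⧸ (Ideal.span (Set.range x) • (⊤ : Submodule R M))) else 0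
  let c₂ : (σ →₀ ℕ) → ℕ∞ := fun α =>
    if α ∈ Finset.univ.finsuppAntidiag n then
      relLength (initColon x M α) (modColon R (initColon x M α) 𝔪) else 0
  have key := relLength_monomial_le x L W S (fun α => c₁ α + c₂ α) ?_
  · have h0 : Ideal.span (monomialEval x '' {β | β ∉ S}) • (⊤ : Submodule R M) ⊔ L = L := by
      refine sup_eq_right.mpr (Submodule.smul_mono_left ?_)
      rw [Ideal.span_le]
      rintro _ ⟨β, hβ, rfl⟩
      have hβ' : ¬ β.degree ≤ n := fun h => hβ ((hS β).mpr h)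
      exact Ideal.pow_le_pow_right (by omega) (monomialEval_mem_pow x β)
    rw [h0, inf_eq_right.mpr hLW, Finset.sum_add_distrib] at key
    refine key.trans (add_le_add ?_ ?_)
    · simp only [c₁]
      rw [← Finset.sum_filter, Finset.sum_const, nsmul_eq_mul]
      gcongr
      intro α hα
      exact (Finset.mem_filter.mp hα).2
    · simp only [c₂]
      rw [← Finset.sum_filter]
      exact Finset.sum_le_sum_of_subset fun α hα => (Finset.mem_filter.mp hα).2
  · intro α hα
    have hαn := (hS α).mp hα
    have hset : {β | β ∉ S ∨ toDegLex α < toDegLex β} = {β | toDegLex α < toDegLex β} := by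
      ext β
      simp only [Set.mem_ofPred_eq, or_iff_right_iff_imp, hS]
      intro h
      rw [Finsupp.DegLex.lt_iff]
      exact Or.inl (lt_of_le_of_lt hαn (not_le.mp h))
    have hsup : Ideal.span (monomialEval x '' {β | toDegLex α < toDegLex β}) •
        (⊤ : Submodule R M) ⊔ L =
          Ideal.span (monomialEval x '' {β | toDegLex α < toDegLex β}) • (⊤ : Submodule R M) :=
      sup_eq_left.mpr (pow_smul_top_le x hαn)
    rw [hset, hsup]
    set F := Ideal.span (monomialEval x '' {β | toDegLex α < toDegLex β}) • (⊤ : Submodule R M)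
      with hF
    have hmem : ∀ z ∈ (W ⊔ F).comap (LinearMap.lsmul R M (monomialEval x α)), ∀ a ∈ 𝔪,
        ∃ w ∈ L, ∃ f ∈ F, monomialEval x α • a • z = w + a • f := by
      intro z hz a ha
      obtain ⟨w, hw, f, hf, hwf⟩ := Submodule.mem_sup.mp hz
      refine ⟨a • w, hw a ha, f, hf, ?_⟩
      rw [← smul_add, hwf, smul_comm]
      rfl
    change relLength (initColon x M α) _ ≤ _
    by_cases hdeg : α ∈ Finset.univ.finsuppAntidiag n
    · refine (relLength_mono_right (C := modColon R (initColon x M α) 𝔪) _ ?_).trans ?_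
      · intro z hz a ha
        obtain ⟨w, hw, f, hf, h⟩ := hmem z hz a ha
        rw [initColon, Submodule.mem_comap, LinearMap.lsmul_apply, h]
        exact add_mem (pow_smul_top_le x hαn hw) (Submodule.smul_mem _ _ hf)
      · simp only [c₂, if_pos hdeg]
        exact le_add_self
    by_cases hbad : ∀ i, initColon x M α ≠ initColon x M (α + Finsupp.single i 1)
    · refine le_trans (relLength_anti_left (smul_top_le_initColon x M α) _) ?_
      refine (relLength_mono_right _ le_top).trans ?_
      rw [relLength_top]
      simp [c₁, hB α hbad]
    · push Not at hbad
      obtain ⟨i, hi⟩ := hbad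
      rw [relLength_eq_zero_of_le]
      · exact zero_le
      · intro z hz
        rw [hi]
        obtain ⟨w, hw, f, hf, h⟩ := hmem z hz (x i) (hx i)
        rw [initColon, Submodule.mem_comap, LinearMap.lsmul_apply, monomialEval_add,
          monomialEval_single, pow_one, mul_smul, h]
        have hlt : (α + Finsupp.single i 1).degree ≤ n := by
          have : α.degree ≠ n := fun h => hdeg (by simpa [Finsupp.degree_eq_sum] using h)
          simp
          omega
        refine add_mem (pow_smul_top_le x hlt hw) ?_
        simpa [monomialEval_single] using monomialEval_smul_mem x (Finsupp.single i 1) hf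

theorem length_quotient_pow_le {R M : Type*} {σ : Type*} [CommRing R] [AddCommGroup M]
    [Module R M] [Fintype σ] [LinearOrder σ] (x : σ → R) (n : ℕ) :
    Module.length R (M ⧸ (Ideal.span (Set.range fun i => x i ^ n) • (⊤ : Submodule R M))) ≤
      ∑ α ∈ Finset.univ.finsupp (fun _ : σ => Finset.range n),
        Module.length R (M ⧸ initColon x M α) := by
  classical
  set L := Ideal.span (Set.range fun i => x i ^ n) • (⊤ : Submodule R M)
  set S := Finset.univ.finsupp (fun _ : σ => Finset.range n)
  have hS : ∀ α, α ∈ S ↔ ∀ i, α i < n := fun α => by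
    simp [S, Finset.mem_finsupp_iff]
  have key := relLength_monomial_le x L ⊤ S (fun α => Module.length R (M ⧸ initColon x M α)) ?_
  · have h0 : Ideal.span (monomialEval x '' {β | β ∉ S}) • (⊤ : Submodule R M) ⊔ L = L := by
      refine sup_eq_right.mpr (Submodule.smul_mono_left ?_)
      rw [Ideal.span_le]
      rintro _ ⟨β, hβ, rfl⟩
      obtain ⟨i, hi⟩ : ∃ i, n ≤ β i := by
        by_contra! h
        exact hβ ((hS β).mpr h)
      refine Ideal.mem_of_dvd _ ?_ (Ideal.subset_span ⟨i, rfl⟩)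
      exact (pow_dvd_pow _ hi).trans
          (Finset.dvd_prod_of_mem (fun i => x i ^ β i) (Finset.mem_univ i))
    rw [h0, top_inf_eq, relLength_top] at key
    exact key
  · intro α _
    rw [← relLength_top]
    refine (relLength_mono_right _ le_top).trans (relLength_anti_left (Submodule.comap_mono ?_) _)
    refine le_sup_of_le_left (Submodule.smul_mono_left (Ideal.span_mono (Set.image_mono ?_)))
    exact fun β hβ => Or.inr hβ

end Bounds

section KillingIdeal

variable {R : Type u} [CommRing R]

theorem mem_smul_top_iff_of_linearEquiv {M M' : Type*} [AddCommGroup M] [Module R M]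
    [AddCommGroup M'] [Module R M'] (e : M ≃ₗ[R] M') (J : Ideal R) (z : M) :
    e z ∈ J • (⊤ : Submodule R M') ↔ z ∈ J • (⊤ : Submodule R M) := by
  have h : (J • (⊤ : Submodule R M)).map (e : M →ₗ[R] M') = J • ⊤ := by
    rw [Submodule.map_smul'', Submodule.map_top, LinearEquiv.range]
  rw [← h]
  constructor
  · rintro ⟨w, hw, hwz⟩
    rwa [← e.injective hwz]
  · exact fun hz => ⟨z, hz, rfl⟩

theorem IsSOP.of_linearEquiv {M M' : Type u} [AddCommGroup M] [Module R M]
    [AddCommGroup M'] [Module R M'] (e : M ≃ₗ[R] M') {s : ℕ} {x : Fin s → R}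
    (hx : IsSOP R M x) : IsSOP R M' x := by
  obtain ⟨h1, h2, h3⟩ := hx
  refine ⟨?_, h2, ?_⟩
  · rw [← h1, moduleDim, moduleDim, e.annihilator_eq]
  · refine IsFiniteLength.of_surjective (f := Submodule.mapQ _ _ (e : M →ₗ[R] M') ?_) h3 ?_
    · intro z hz
      exact (mem_smul_top_iff_of_linearEquiv e _ z).mpr hz
    · intro w
      obtain ⟨w, rfl⟩ := Submodule.mkQ_surjective _ w
      exact ⟨Submodule.mkQ _ (e.symm w), by simp⟩

theorem mem_bIdeal_iff {M : Type u} [AddCommGroup M] [Module R M] {c : R} :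
    c ∈ bIdeal R M ↔ ∀ (s : ℕ) (x : Fin s → R), IsSOP R M x → ∀ (i : Fin s) (z : M),
      x i • z ∈ Ideal.span (x '' {j | j < i}) • (⊤ : Submodule R M) →
        c • z ∈ Ideal.span (x '' {j | j < i}) • (⊤ : Submodule R M) := by
  simp only [bIdeal, Submodule.mem_iInf, Submodule.mem_annihilator, Submodule.mem_torsionBy_iff]
  refine forall_congr' fun s => forall_congr' fun x => forall_congr' fun _ =>
    forall_congr' fun i => ?_
  constructor
  · intro h z hz
    have := h (Submodule.Quotient.mk z)
      (by rwa [← Submodule.Quotient.mk_smul, Submodule.Quotient.mk_eq_zero])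
    rwa [← Submodule.Quotient.mk_smul, Submodule.Quotient.mk_eq_zero] at this
  · intro h z hz
    obtain ⟨z, rfl⟩ := Submodule.Quotient.mk_surjective _ z
    rw [← Submodule.Quotient.mk_smul, Submodule.Quotient.mk_eq_zero] at hz ⊢
    exact h z hz

theorem bIdeal_le_of_linearEquiv {M M' : Type u} [AddCommGroup M] [Module R M]
    [AddCommGroup M'] [Module R M'] (e : M ≃ₗ[R] M') : bIdeal R M' ≤ bIdeal R M := by
  intro c hc
  rw [mem_bIdeal_iff] at hc ⊢
  intro s x hx i z hz
  rw [← mem_smul_top_iff_of_linearEquiv e, map_smul]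
  refine hc s x (hx.of_linearEquiv e) i _ ?_
  rwa [← map_smul, mem_smul_top_iff_of_linearEquiv]

theorem length_quotient_pow_ne_top {M : Type*} [AddCommGroup M] [Module R M] {s : ℕ}
    {x : Fin s → R} (hx : IsFiniteLength R (M ⧸ (Ideal.span (Set.range x) • (⊤ : Submodule R M))))
    (n : Fin s → ℕ) :
    Module.length R (M ⧸ (Ideal.span (Set.range fun i => x i ^ n i) • (⊤ : Submodule R M))) ≠
      ⊤ := by
  set N := Finset.univ.sup n
  have h1 : Ideal.span (Set.range fun i => x i ^ N) • (⊤ : Submodule R M) ≤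
      Ideal.span (Set.range fun i => x i ^ n i) • (⊤ : Submodule R M) := by
    refine Submodule.smul_mono_left ?_
    rw [Ideal.span_le]
    rintro _ ⟨i, rfl⟩
    exact Ideal.mem_of_dvd _ (pow_dvd_pow _ (Finset.le_sup (Finset.mem_univ i)))
      (Ideal.subset_span ⟨i, rfl⟩)
  refine ne_top_of_le_ne_top ?_
    (Module.length_le_of_surjective _ (Submodule.factor_surjective h1))
  refine ne_top_of_le_ne_top ?_ (length_quotient_pow_le x N)
  rw [← lt_top_iff_ne_top, ENat.sum_lt_top]
  intro α _
  refine lt_of_le_of_lt (Module.length_le_of_surjective _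
    (Submodule.factor_surjective (smul_top_le_initColon x M α))) ?_
  exact lt_top_iff_ne_top.mpr (Module.length_ne_top_iff.mpr hx)

theorem IsSOP.pow_comp [IsLocalRing R] {M : Type u} [AddCommGroup M] [Module R M] {s : ℕ}
    {x : Fin s → R}
    (hx : IsSOP R M x) (n : Fin s → ℕ) (hn : ∀ i, n i ≠ 0) (σ : Equiv.Perm (Fin s)) :
    IsSOP R M fun k => x (σ k) ^ n (σ k) := by
  refine ⟨hx.1, fun k => ?_, ?_⟩
  · intro h
    exact hx.2.1 (σ k) ((isUnit_pow_iff (hn _)).mp h)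
  · have : Set.range (fun k => x (σ k) ^ n (σ k)) = Set.range fun i => x i ^ n i :=
      σ.surjective.range_comp fun i => x i ^ n i
    rw [this]
    exact Module.length_ne_top_iff.mp (length_quotient_pow_ne_top hx.2.2 n)

theorem exists_perm_image_lt {s : ℕ} (T : Set (Fin s)) (i : Fin s) (hi : i ∉ T) :
    ∃ (σ : Equiv.Perm (Fin s)) (k : Fin s), σ k = i ∧ σ '' {j | j < k} = T := by
  classical
  let f : Fin s → ℕ := fun j => if j ∈ T then 0 else if j = i then 1 else 2
  set σ := Tuple.sort f
  have hmono : Monotone (f ∘ σ) := Tuple.monotone_sort f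
  refine ⟨σ, σ.symm i, by simp, ?_⟩
  have hfi : f i = 1 := by simp [f, hi]
  have hiff : ∀ j, f j < 1 ↔ j ∈ T := fun j => by
    simp only [f]; split_ifs <;> simp_all
  ext j
  constructor
  · rintro ⟨k, hk, rfl⟩
    have h1 := hmono (le_of_lt hk)
    simp only [Function.comp_apply, Equiv.apply_symm_apply, hfi] at h1
    rw [← hiff]
    refine lt_of_le_of_ne h1 fun h => ?_
    have : σ k = i := by
      simp only [f] at h
      split_ifs at h <;> simp_all
    rw [← this, Equiv.symm_apply_apply] at hk
    exact lt_irrefl k hk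
  · intro hj
    refine ⟨σ.symm j, ?_, by simp⟩
    by_contra hle
    have h1 := hmono (not_lt.mp hle)
    simp only [Function.comp_apply, Equiv.apply_symm_apply, hfi] at h1
    exact absurd ((hiff j).mpr hj) (by omega)

theorem smul_mem_of_mem_bIdeal [IsLocalRing R] {M : Type u} [AddCommGroup M] [Module R M] {s : ℕ}
    {x : Fin s → R}
    (hx : IsSOP R M x) {c : R} (hc : c ∈ bIdeal R M) (n : Fin s → ℕ) (hn : ∀ i, n i ≠ 0)
    {T : Set (Fin s)} {i : Fin s} (hi : i ∉ T) {z : M}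
    (hz : x i ^ n i • z ∈ Ideal.span ((fun j => x j ^ n j) '' T) • (⊤ : Submodule R M)) :
    c • z ∈ Ideal.span ((fun j => x j ^ n j) '' T) • (⊤ : Submodule R M) := by
  obtain ⟨σ, k, rfl, rfl⟩ := exists_perm_image_lt T i hi
  have := mem_bIdeal_iff.mp hc s _ (hx.pow_comp n hn σ) k z
  rw [Set.image_image] at hz ⊢
  exact this hz

theorem IsCSOP.last_mem_bIdeal {M : Type u} [AddCommGroup M] [Module R M] {t : ℕ}
    {x : Fin (t + 1) → R} (hx : IsCSOP R M x) : x (Fin.last t) ∈ bIdeal R M ^ 3 := by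
  have h := hx.2 (Fin.last t)
  have he : Ideal.span (x '' {j | Fin.last t < j}) • (⊤ : Submodule R M) = ⊥ := by
    have : {j | Fin.last t < j} = ∅ := by
      ext j
      simpa using Fin.le_last j
    rw [this]
    simp
  rw [he] at h
  exact Ideal.pow_right_mono (bIdeal_le_of_linearEquiv (Submodule.quotEquivOfEqBot ⊥ rfl).symm) 3 h

end KillingIdeal

section Regular

/-- The element `c` annihilates every quotient `(J M : x i ^ n i) / J M`, where `J` is generated
by powers of some of the other members of the family `x`. -/
def AnnihilatesColons {R ι : Type*} [CommRing R] (x : ι → R) (M : Type*) [AddCommGroup M]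
    [Module R M] (c : R) : Prop :=
  ∀ (n : ι → ℕ), (∀ i, n i ≠ 0) → ∀ (T : Set ι), ∀ i ∉ T, ∀ z : M,
    x i ^ n i • z ∈ Ideal.span ((fun j => x j ^ n j) '' T) • (⊤ : Submodule R M) →
      c • z ∈ Ideal.span ((fun j => x j ^ n j) '' T) • (⊤ : Submodule R M)

variable {R : Type u} [CommRing R] {M : Type u} [AddCommGroup M] [Module R M]

theorem AnnihilatesColons.smul_mem_pow {ι : Type*} {x : ι → R} {c : R}
    (h : AnnihilatesColons x M c) {ν : ι → ℕ} (hν : ∀ i, ν i ≠ 0) {T : Set ι} {i : ι} (hi : i ∉ T)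
    {k : ℕ} (hk : k ≠ 0) {z : M}
    (hz : x i ^ k • z ∈ Ideal.span ((fun j => x j ^ ν j) '' T) • (⊤ : Submodule R M)) :
    c • z ∈ Ideal.span ((fun j => x j ^ ν j) '' T) • (⊤ : Submodule R M) := by
  classical
  have hT : (fun j => x j ^ Function.update ν i k j) '' T = (fun j => x j ^ ν j) '' T := by
    refine Set.image_congr fun j hj => ?_
    have : j ≠ i := fun h => hi (h ▸ hj)
    simp [Function.update_of_ne this]
  have := h (Function.update ν i k) (fun j => ?_) T i hi z
  · rw [hT] at this
    exact this (by simpa using hz)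
  · by_cases hj : j = i
    · subst hj; simpa using hk
    · simpa [Function.update_of_ne hj] using hν j

theorem AnnihilatesColons.smul_mem {ι : Type*} {x : ι → R} {c : R}
    (h : AnnihilatesColons x M c) {T : Set ι} {i : ι} (hi : i ∉ T) {k : ℕ} (hk : k ≠ 0) {z : M}
    (hz : x i ^ k • z ∈ Ideal.span (x '' T) • (⊤ : Submodule R M)) :
    c • z ∈ Ideal.span (x '' T) • (⊤ : Submodule R M) := by
  simpa using h.smul_mem_pow (ν := fun _ => 1) (fun _ => one_ne_zero) hi hk (by simpa using hz)

theorem exists_add_smul_of_mem_span_insert {r : R} {S : Set R} {z : M}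
    (hz : z ∈ Ideal.span (insert r S) • (⊤ : Submodule R M)) :
    ∃ p ∈ Ideal.span S • (⊤ : Submodule R M), ∃ w : M, z = p + r • w := by
  rw [Ideal.span_insert, Submodule.sup_smul] at hz
  obtain ⟨a, ha, p, hp, rfl⟩ := Submodule.mem_sup.mp hz
  rw [Submodule.ideal_span_singleton_smul, Submodule.mem_smul_pointwise_iff_exists] at ha
  obtain ⟨w, _, rfl⟩ := ha
  exact ⟨p, hp, w, add_comm _ _⟩

theorem mem_of_last_smul_mem [IsLocalRing R] [IsNoetherian R M] {t : ℕ} {x : Fin (t + 1) → R}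
    (hx : ∀ i, x i ∈ maximalIdeal R) (hkill : AnnihilatesColons x M (x (Fin.last t)))
    (h : ∀ z : M, x (Fin.last t) • z ∈ Ideal.span (x '' {j | j.val < t}) • (⊤ : Submodule R M) →
      z ∈ Ideal.span (x '' {j | j.val < t}) • (⊤ : Submodule R M)) {k : ℕ} (hk : k ≤ t) :
    ∀ z : M, x (Fin.last t) • z ∈ Ideal.span (x '' {j | j.val < k}) • (⊤ : Submodule R M) →
      z ∈ Ideal.span (x '' {j | j.val < k}) • (⊤ : Submodule R M) := by
  induction hk using Nat.decreasingInduction with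
  | self => exact h
  | of_succ k hk ih =>
    set y := x (Fin.last t)
    set P := Ideal.span (x '' {j | j.val < k}) • (⊤ : Submodule R M) with hP
    let i : Fin (t + 1) := ⟨k, by omega⟩
    have hset : x '' {j | j.val < k + 1} = insert (x i) (x '' {j | j.val < k}) := by
      rw [← Set.image_insert_eq]
      congr 1
      ext j
      simp only [Set.mem_ofPred_eq, Set.mem_insert_iff, Fin.ext_iff, i]
      omega
    have hi : i ∉ {j : Fin (t + 1) | j.val < k} := by simp [i]
    have hl : Fin.last t ∉ {j : Fin (t + 1) | j.val < k} := by simp; omega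
    let V : Submodule R M := P.comap (LinearMap.lsmul R M y)
    have hV : V ≤ P ⊔ maximalIdeal R • V := by
      intro z hz
      have hz : y • z ∈ P := hz
      have hsub : x '' {j | j.val < k} ⊆ x '' {j | j.val < k + 1} := by
        rw [hset]
        exact Set.subset_insert _ _
      have hz1 := ih z (Submodule.smul_mono_left (Ideal.span_mono hsub) hz)
      rw [hset] at hz1
      obtain ⟨p, hp, w, rfl⟩ := exists_add_smul_of_mem_span_insert hz1
      refine Submodule.add_mem_sup hp (Submodule.smul_mem_smul (hx i) ?_)
      have h1 : x i ^ 1 • y • w ∈ P := by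
        rw [pow_one, smul_comm]
        have := sub_mem hz (P.smul_mem y hp)
        rwa [smul_add, add_sub_cancel_left] at this
      have h2 := hkill.smul_mem hi one_ne_zero h1
      rw [← mul_smul, ← pow_two] at h2
      exact hkill.smul_mem hl two_ne_zero h2
    exact fun z hz => Submodule.le_of_le_smul_of_le_jacobson_bot (IsNoetherian.noetherian V)
      (maximalIdeal_le_jacobson _) hV hz

theorem isCMMod_of_last_smul_mem [IsLocalRing R] [IsNoetherianRing R] [Module.Finite R M] {t : ℕ}
    {x : Fin (t + 1) → R}
    (hx : ∀ i, x i ∈ maximalIdeal R) (hkill : AnnihilatesColons x M (x (Fin.last t)))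
    (h : ∀ z : M, x (Fin.last t) • z ∈ Ideal.span (x '' {j | j.val < t}) • (⊤ : Submodule R M) →
      z ∈ Ideal.span (x '' {j | j.val < t}) • (⊤ : Submodule R M))
    (hdim : moduleDim R M = ((t + 1 : ℕ) : WithBot ℕ∞)) : IsCMMod R M := by
  have hnt : Nontrivial M := by
    by_contra hM
    rw [not_nontrivial_iff_subsingleton] at hM
    have : Subsingleton (R ⧸ Module.annihilator R M) := by
      rw [Module.annihilator_eq_top_iff.mpr hM]
      exact Ideal.Quotient.subsingleton_iff.mpr rfl
    rw [moduleDim, ringKrullDim_eq_bot_of_subsingleton] at hdim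
    exact WithBot.bot_ne_coe hdim
  have hmem : ∀ r ∈ List.ofFn x, r ∈ maximalIdeal R := by
    intro r hr
    obtain ⟨i, rfl⟩ := List.mem_ofFn.mp hr
    exact hx i
  refine isCMMod_of_isRegular M (List.ofFn x) hmem ?_ (by simpa using hdim)
  rw [IsLocalRing.isRegular_iff_isWeaklyRegular_of_subset_maximalIdeal hmem,
    RingTheory.Sequence.isWeaklyRegular_iff]
  intro k hk
  have hk' : k < t + 1 := by simpa using hk
  have hJ : Ideal.ofList ((List.ofFn x).take k) = Ideal.span (x '' {j | j.val < k}) := by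
    rw [Ideal.ofList]
    congr 1
    ext r
    simp only [Set.mem_ofPred_eq, Set.mem_image, List.mem_take_iff_getElem]
    constructor
    · rintro ⟨j, hj, rfl⟩
      rw [List.length_ofFn] at hj
      exact ⟨⟨j, by omega⟩, by simp; omega, (List.getElem_ofFn _).symm⟩
    · rintro ⟨j, hj, rfl⟩
      exact ⟨j.val, by simp; omega, List.getElem_ofFn _⟩
  rw [hJ, isSMulRegular_quotient_iff_mem_of_smul_mem]
  intro z hz
  simp only [List.getElem_ofFn] at hz
  have hk0 : (⟨k, hk'⟩ : Fin (t + 1)) ∉ {j : Fin (t + 1) | j.val < k} := by simp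
  refine mem_of_last_smul_mem hx hkill h (by omega) z
    (hkill.smul_mem hk0 one_ne_zero (by simpa using hz))

end Regular

section Socle

variable {R : Type u} [CommRing R] {M : Type u} [AddCommGroup M] [Module R M]

theorem exists_socle_lift {𝔪 b : Ideal R} (hb𝔪 : b ≤ 𝔪) {P : Submodule R M} {y : R}
    (hkill : ∀ c ∈ b, ∀ k ≠ 0, ∀ z : M, y ^ k • z ∈ P → c • z ∈ P) (hy : y ∈ b * b) {z : M}
    (hz : ∀ a ∈ 𝔪, ∃ w, y • (a • z - y • w) ∈ P) :
    ∃ h, y • h ∈ P ∧ ∀ a ∈ 𝔪, ∃ w, a • (z - h) - y • w ∈ P := by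
  choose! w hw using hz
  have key : ∀ τ ∈ b * b, ∃ u, y • u - τ • z ∈ P ∧ ∀ a ∈ 𝔪, a • u - τ • w a ∈ P := by
    intro τ hτ
    refine Submodule.mul_induction_on hτ ?_ ?_
    · intro β hβ γ hγ
      refine ⟨β • w γ, ?_, fun a ha => ?_⟩
      · have h1 := hkill β hβ 1 one_ne_zero _ (by simpa using hw γ (hb𝔪 hγ))
        have h2 : y • β • w γ - (β * γ) • z = -(β • (γ • z - y • w γ)) := by
          module
        rw [h2]
        exact neg_mem h1
      · have h1 : y ^ 2 • (a • w γ - γ • w a) ∈ P := by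
          have h2 : y ^ 2 • (a • w γ - γ • w a) =
              γ • y • (a • z - y • w a) - a • y • (γ • z - y • w γ) := by module
          rw [h2]
          exact sub_mem (P.smul_mem _ (hw a ha)) (P.smul_mem _ (hw γ (hb𝔪 hγ)))
        have h3 : a • β • w γ - (β * γ) • w a = β • (a • w γ - γ • w a) := by module
        rw [h3]
        exact hkill β hβ 2 two_ne_zero _ h1
    · rintro τ₁ τ₂ ⟨u₁, h₁, h₁'⟩ ⟨u₂, h₂, h₂'⟩
      refine ⟨u₁ + u₂, ?_, fun a ha => ?_⟩
      · have : y • (u₁ + u₂) - (τ₁ + τ₂) • z = (y • u₁ - τ₁ • z) + (y • u₂ - τ₂ • z) := by module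
        rw [this]
        exact add_mem h₁ h₂
      · have : a • (u₁ + u₂) - (τ₁ + τ₂) • w a =
          (a • u₁ - τ₁ • w a) + (a • u₂ - τ₂ • w a) := by module
        rw [this]
        exact add_mem (h₁' a ha) (h₂' a ha)
  obtain ⟨u, hu, hu'⟩ := key y hy
  refine ⟨z - u, ?_, fun a ha => ⟨w a, ?_⟩⟩
  · have : y • (z - u) = -(y • u - y • z) := by module
    rw [this]
    exact neg_mem hu
  · rw [sub_sub_cancel]
    exact hu' a ha

theorem one_le_relLength {A B : Submodule R M} (h : ¬ B ≤ A) : 1 ≤ relLength A B := by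
  rw [Order.one_le_iff_pos, relLength, Module.length_pos_iff]
  rw [Submodule.nontrivial_iff_ne_bot]
  intro h0
  refine h fun z hz => ?_
  have : A.mkQ z ∈ B.map A.mkQ := ⟨z, hz, rfl⟩
  rw [h0] at this
  simpa using this

variable [IsLocalRing R]

theorem exists_mem_modColon_of_not_le {Q K : Submodule R M} (hQ : IsFiniteLength R (M ⧸ Q))
    (hK : ¬ K ≤ Q) : ∃ z ∈ K, z ∈ modColon R Q (maximalIdeal R) ∧ z ∉ Q := by
  obtain ⟨hN, hA⟩ := isFiniteLength_iff_isNoetherian_isArtinian.mp hQ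
  obtain h0 | ⟨S, hS, hSK⟩ := IsAtomic.eq_bot_or_exists_atom_le (K.map Q.mkQ)
  · refine absurd (fun z hz => ?_) hK
    have : Q.mkQ z ∈ K.map Q.mkQ := ⟨z, hz, rfl⟩
    rw [h0] at this
    simpa using this
  have hmS : maximalIdeal R • S = ⊥ := by
    obtain h | h := hS.le_iff.mp (Submodule.smul_le_right : maximalIdeal R • S ≤ S)
    · exact h
    · exact absurd (Submodule.eq_bot_of_le_smul_of_le_jacobson_bot _ _
        (IsNoetherian.noetherian S) h.ge (maximalIdeal_le_jacobson _)) hS.1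
  obtain ⟨d, hd, hd0⟩ := (Submodule.ne_bot_iff _).mp hS.1
  obtain ⟨z, hz, rfl⟩ := hSK hd
  refine ⟨z, hz, fun a ha => ?_, fun h => hd0 (by simpa using h)⟩
  have : a • Q.mkQ z ∈ maximalIdeal R • S := Submodule.smul_mem_smul ha hd
  rw [hmS, Submodule.mem_bot, ← map_smul] at this
  exact (Submodule.Quotient.mk_eq_zero Q).mp this

theorem relLength_modColon_add_one_le {b : Ideal R} {P : Submodule R M} {y : R}
    (hkill : ∀ c ∈ b, ∀ k ≠ 0, ∀ z : M, y ^ k • z ∈ P → c • z ∈ P) (hy : y ∈ b * b)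
    (hfin : IsFiniteLength R (M ⧸ (P ⊔ LinearMap.range (LinearMap.lsmul R M y))))
    {h : M} (hyh : y • h ∈ P) (hh : h ∉ P) :
    relLength (P.comap (LinearMap.lsmul R M y) ⊔ LinearMap.range (LinearMap.lsmul R M y))
        (modColon R (P.comap (LinearMap.lsmul R M y) ⊔ LinearMap.range (LinearMap.lsmul R M y))
          (maximalIdeal R)) + 1 ≤
      relLength (P ⊔ LinearMap.range (LinearMap.lsmul R M y))
        (modColon R (P ⊔ LinearMap.range (LinearMap.lsmul R M y)) (maximalIdeal R)) := by
  set K := P.comap (LinearMap.lsmul R M y) ⊔ LinearMap.range (LinearMap.lsmul R M y)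
  set Q := P ⊔ LinearMap.range (LinearMap.lsmul R M y)
  have hb𝔪 : b ≤ maximalIdeal R := le_maximalIdeal fun hb => hh (by
    simpa using hkill 1 (hb ▸ trivial) 1 one_ne_zero h (by simpa using hyh))
  have hQK : Q ≤ K := sup_le_sup_right (fun z hz => P.smul_mem y hz) _
  have hQW : Q ≤ modColon R Q (maximalIdeal R) := fun z hz r _ => Q.smul_mem r hz
  have hsocle : modColon R K (maximalIdeal R) ≤ K ⊔ modColon R Q (maximalIdeal R) := by
    intro z hz
    obtain ⟨h', hyh', hh'⟩ := exists_socle_lift hb𝔪 hkill hy (z := z) fun a ha => by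
      obtain ⟨g, hg, _, ⟨w, rfl⟩, hgw⟩ := Submodule.mem_sup.mp (hz a ha)
      refine ⟨w, ?_⟩
      rw [← hgw]
      simpa using hg
    have : z = h' + (z - h') := by abel
    rw [this]
    refine Submodule.add_mem_sup (Submodule.mem_sup_left hyh') fun a ha => ?_
    obtain ⟨w, hw⟩ := hh' a ha
    exact Submodule.mem_sup.mpr ⟨_, hw, _, ⟨w, rfl⟩, by simp⟩
  have hKQ : ¬ K ≤ Q := fun hle => hh (by
    obtain ⟨p, hp, _, ⟨u, rfl⟩, hpu⟩ :=
      Submodule.mem_sup.mp (hle (Submodule.mem_sup_left (show y • h ∈ P from hyh)))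
    have hyb : y ∈ b := Ideal.mul_le_right hy
    rw [← hpu] at hyh ⊢
    refine add_mem hp (hkill y hyb 2 two_ne_zero u ?_)
    have h1 := sub_mem hyh (P.smul_mem y hp)
    rw [smul_add, add_sub_cancel_left] at h1
    rw [pow_two, mul_smul]
    exact h1)
  rw [relLength_eq_add (B := K ⊓ modColon R Q (maximalIdeal R)) (le_inf hQK hQW) inf_le_right,
    relLength_inf_left, add_comm]
  refine add_le_add (one_le_relLength fun hle => ?_) ?_
  · obtain ⟨z, hzK, hzW, hzQ⟩ := exists_mem_modColon_of_not_le hfin hKQ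
    exact hzQ (hle ⟨hzK, hzW⟩)
  · rw [← relLength_sup K (modColon R Q (maximalIdeal R))]
    exact relLength_mono_right _ hsocle

end Socle

section LowerBound

variable {R M : Type*} [CommRing R] [AddCommGroup M] [Module R M]

theorem relLength_add_le_of_smul_saturated {y : R} {B C D : Submodule R M} {g : M →ₗ[R] M}
    (hBD : B ≤ D) (hD : ∀ z, y • z ∈ D → z ∈ D) (hg : ∀ z, g z ∈ B ↔ z ∈ C)
    (hgD : ∀ z, g z ∈ D) (hyD : ∀ z ∈ D, y • z ∈ B ⊔ LinearMap.range g) :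
    relLength (C ⊔ LinearMap.range (LinearMap.lsmul R M y)) ⊤ +
        relLength (D ⊔ LinearMap.range (LinearMap.lsmul R M y)) ⊤ ≤
      relLength (B ⊔ LinearMap.range (LinearMap.lsmul R M y)) ⊤ := by
  set f := LinearMap.lsmul R M y
  set D' := B ⊔ LinearMap.range g
  have hD'D : D' ≤ D := sup_le hBD (by rintro _ ⟨z, rfl⟩; exact hgD z)
  have hyDD' : B ⊔ D.map f ≤ D' := sup_le le_sup_left (by rintro _ ⟨z, hz, rfl⟩; exact hyD z hz)
  have hD'f : D'.map f ≤ D' := by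
    rintro _ ⟨z, hz, rfl⟩
    exact D'.smul_mem y hz
  rw [relLength_eq_add (sup_le_sup_right hBD (LinearMap.range f)) le_top]
  refine add_le_add_left ?_ _
  have h1 : relLength (B ⊔ LinearMap.range f) (D ⊔ LinearMap.range f) =
      relLength (B ⊔ D.map f) D := by
    have h2 : D ⊔ LinearMap.range f = (B ⊔ LinearMap.range f) ⊔ D := by
      rw [sup_right_comm, sup_eq_right.mpr hBD]
    rw [h2, relLength_sup, ← relLength_inf_left]
    congr 1
    refine le_antisymm ?_ (le_inf (sup_le_sup_left (LinearMap.map_le_range) _)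
      (hyDD'.trans hD'D))
    rintro _ ⟨hz, hzD⟩
    obtain ⟨b, hb, _, ⟨w, rfl⟩, rfl⟩ := Submodule.mem_sup.mp hz
    have hw : f w ∈ D := by simpa using sub_mem hzD (hBD hb)
    exact Submodule.add_mem_sup hb ⟨w, hD w hw, rfl⟩
  rw [h1]
  have h2 : relLength (C ⊔ LinearMap.range f) ⊤ ≤ relLength (B ⊔ D'.map f) D' := by
    calc relLength (C ⊔ LinearMap.range f) ⊤
        ≤ relLength ((B ⊔ D'.map f).comap g) ⊤ := by
          refine relLength_anti_left ?_ _
          intro z hz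
          obtain ⟨b, hb, _, ⟨_, hd, rfl⟩, hbd⟩ := Submodule.mem_sup.mp hz
          obtain ⟨b', hb', _, ⟨w, rfl⟩, rfl⟩ := Submodule.mem_sup.mp hd
          have h3 : z - y • w ∈ C := by
            rw [← hg]
            have h4 : g (z - y • w) = b + y • b' := by
              rw [map_sub, map_smul, ← hbd]
              simp only [f, LinearMap.lsmul_apply, smul_add]
              abel
            rw [h4]
            exact add_mem hb (B.smul_mem y hb')
          have h5 : z = (z - y • w) + y • w := by abel
          rw [h5]
          exact Submodule.add_mem_sup h3 ⟨w, rfl⟩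
      _ = relLength (B ⊔ D'.map f) (LinearMap.range g) := by
          rw [relLength_comap, Submodule.map_top]
      _ ≤ _ := relLength_mono_right _ le_sup_right
  refine h2.trans ?_
  have h3 : relLength (B ⊔ D'.map f) D' + relLength D' D =
      relLength (B ⊔ D'.map f) (B ⊔ D.map f) + relLength (B ⊔ D.map f) D := by
    rw [← relLength_eq_add (sup_le le_sup_left hD'f) hD'D,
      ← relLength_eq_add (sup_le_sup_left (Submodule.map_mono hD'D) _) (hyDD'.trans hD'D)]
  have h4 : relLength (B ⊔ D'.map f) (B ⊔ D.map f) ≤ relLength D' D := by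
    calc relLength (B ⊔ D'.map f) (B ⊔ D.map f)
        ≤ relLength (B ⊔ D'.map f) ((B ⊔ D'.map f) ⊔ D.map f) :=
          relLength_mono_right _ (sup_le_sup_right le_sup_left _)
      _ = relLength ((B ⊔ D'.map f).comap f) D := by rw [relLength_sup, relLength_comap]
      _ ≤ relLength D' D := by
          refine relLength_anti_left ?_ _
          rw [← Submodule.map_le_iff_le_comap]
          exact le_sup_right
  have h5 : relLength D' D ≤ relLength (B ⊔ D.map f) D := relLength_anti_left hyDD' _
  by_cases htop : relLength (B ⊔ D.map f) D = ⊤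
  · rw [htop]
    exact le_top
  · have hfin : relLength D' D ≠ ⊤ := ne_top_of_le_ne_top htop h5
    refine (ENat.add_le_add_iff_right hfin).mp ?_
    rw [h3, add_comm]
    exact add_le_add_right h4 _

theorem nsmul_relLength_le_of_smul_saturated {y : R} {B : Submodule R M}
    (hB : ∀ z, y • z ∈ B → z ∈ B) (m : ℕ) :
    m * relLength (B ⊔ LinearMap.range (LinearMap.lsmul R M y)) ⊤ ≤
      relLength (B ⊔ LinearMap.range (LinearMap.lsmul R M (y ^ m))) ⊤ := by
  induction m with
  | zero => simp
  | succ m ih =>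
    have hle : LinearMap.range (LinearMap.lsmul R M (y ^ (m + 1))) ≤
        LinearMap.range (LinearMap.lsmul R M (y ^ m)) := by
      rintro _ ⟨z, rfl⟩
      exact ⟨y • z, by rw [LinearMap.lsmul_apply, LinearMap.lsmul_apply, pow_succ, mul_smul]⟩
    have hB' : ∀ z, y ^ m • z ∈ B → z ∈ B := by
      clear ih hle
      induction m with
      | zero => simp
      | succ m ih => exact fun z hz => ih z (hB _ (by rwa [← mul_smul, ← pow_succ']))
    rw [relLength_eq_add (sup_le_sup_left hle B) le_top, Nat.cast_add, Nat.cast_one, add_mul,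
      one_mul, add_comm]
    refine add_le_add ?_ ih
    calc _ ≤ relLength ((B ⊔ LinearMap.range (LinearMap.lsmul R M (y ^ (m + 1)))).comap
          (LinearMap.lsmul R M (y ^ m))) ⊤ := by
          refine relLength_anti_left ?_ _
          intro z hz
          obtain ⟨b, hb, _, ⟨w, rfl⟩, hbw⟩ := Submodule.mem_sup.mp hz
          have h1 : z - y • w ∈ B := by
            refine hB' _ ?_
            rw [LinearMap.lsmul_apply, LinearMap.lsmul_apply, pow_succ, mul_smul] at hbw
            rw [smul_sub, ← hbw, add_sub_cancel_right]
            exact hb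
          rw [← sub_add_cancel z (y • w)]
          exact Submodule.add_mem_sup h1 ⟨w, rfl⟩
      _ = relLength (B ⊔ LinearMap.range (LinearMap.lsmul R M (y ^ (m + 1))))
          (LinearMap.range (LinearMap.lsmul R M (y ^ m))) := by
          rw [relLength_comap, Submodule.map_top]
      _ ≤ _ := relLength_mono_right _ le_sup_right

end LowerBound

section PowColon

variable {R M : Type u} [CommRing R] [AddCommGroup M] [Module R M] {ι : Type*}

/-- The colon `(x i ^ ν i : i ≠ l) M : x l`. -/
def powColon (x : ι → R) (M : Type*) [AddCommGroup M] [Module R M] (l : ι) (ν : ι → ℕ) :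
    Submodule R M :=
  (Ideal.span ((fun j => x j ^ ν j) '' {j | j ≠ l}) • (⊤ : Submodule R M)).comap
    (LinearMap.lsmul R M (x l))

theorem mem_powColon {x : ι → R} {l : ι} {ν : ι → ℕ} {z : M} : z ∈ powColon x M l ν ↔
    x l • z ∈ Ideal.span ((fun j => x j ^ ν j) '' {j | j ≠ l}) • (⊤ : Submodule R M) :=
  Iff.rfl

variable {x : ι → R} {l : ι}

theorem mem_powColon_of_smul_mem (h : AnnihilatesColons x M (x l)) {ν : ι → ℕ}
    (hν : ∀ i, ν i ≠ 0) {z : M} (hz : x l • z ∈ powColon x M l ν) : z ∈ powColon x M l ν := by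
  refine h.smul_mem_pow hν (i := l) (by simp) two_ne_zero ?_
  rw [pow_two, mul_smul]
  exact hz

variable [DecidableEq ι]

theorem mem_powColon_update {ν : ι → ℕ} {k : ι} (hk : k ≠ l) {a : ℕ} {z : M} :
    z ∈ powColon x M l (Function.update ν k a) ↔
      ∃ p ∈ Ideal.span ((fun j => x j ^ ν j) '' {j | j ≠ l ∧ j ≠ k}) • (⊤ : Submodule R M),
        ∃ w, x l • z = p + x k ^ a • w := by
  have hset : (fun j => x j ^ Function.update ν k a j) '' {j | j ≠ l} =
      insert (x k ^ a) ((fun j => x j ^ ν j) '' {j | j ≠ l ∧ j ≠ k}) := by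
    have h1 : {j | j ≠ l} = insert k {j | j ≠ l ∧ j ≠ k} := by
      ext j
      by_cases hj : j = k
      · simp [hj, hk]
      · simp [hj]
    rw [h1, Set.image_insert_eq]
    congr 1
    · simp
    · exact Set.image_congr fun j hj => by simp [Function.update_of_ne hj.2]
  rw [mem_powColon, hset]
  refine ⟨exists_add_smul_of_mem_span_insert, ?_⟩
  rintro ⟨p, hp, w, h⟩
  rw [h]
  refine add_mem (Submodule.smul_mono_left (Ideal.span_mono (Set.subset_insert _ _)) hp) ?_
  exact Submodule.smul_mem_smul (Ideal.subset_span (Set.mem_insert _ _)) trivial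

theorem relLength_powColon_add_le (h : AnnihilatesColons x M (x l)) {ν : ι → ℕ}
    (hν : ∀ i, ν i ≠ 0) {k : ι} (hk : k ≠ l) {a : ℕ} (ha : a ≠ 0) :
    relLength (powColon x M l (Function.update ν k 1) ⊔
          LinearMap.range (LinearMap.lsmul R M (x l))) ⊤ +
        relLength (powColon x M l (Function.update ν k a) ⊔
          LinearMap.range (LinearMap.lsmul R M (x l))) ⊤ ≤
      relLength (powColon x M l (Function.update ν k (a + 1)) ⊔
          LinearMap.range (LinearMap.lsmul R M (x l))) ⊤ := by
  have hν' : ∀ b ≠ 0, ∀ i, Function.update ν k b i ≠ 0 := fun b hb i => by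
    by_cases hi : i = k
    · subst hi; simpa using hb
    · simpa [Function.update_of_ne hi] using hν i
  refine relLength_add_le_of_smul_saturated (g := LinearMap.lsmul R M (x k ^ a)) ?_
    (fun z => mem_powColon_of_smul_mem h (hν' a ha)) ?_ ?_ ?_
  · intro z hz
    rw [mem_powColon_update hk] at hz ⊢
    obtain ⟨p, hp, w, hw⟩ := hz
    exact ⟨p, hp, x k • w, by rw [hw, pow_succ, mul_smul]⟩
  · intro z
    rw [LinearMap.lsmul_apply]
    constructor
    · intro hz
      refine mem_powColon_of_smul_mem h (hν' 1 one_ne_zero) ?_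
      rw [mem_powColon_update hk] at hz ⊢
      obtain ⟨p, hp, w, hw⟩ := hz
      have h1 : x k ^ a • (x l • z - x k • w) = p := by
        rw [smul_sub, smul_comm, hw, pow_succ, mul_smul, add_sub_cancel_right]
      have h2 := h.smul_mem_pow hν (i := k) (T := {j | j ≠ l ∧ j ≠ k}) (by simp) ha
        (by rw [h1]; exact hp)
      exact ⟨_, h2, x l • w, by module⟩
    · intro hz
      rw [mem_powColon_update hk] at hz ⊢
      obtain ⟨p, hp, w, hw⟩ := hz
      refine ⟨_, Submodule.smul_mem _ (x k ^ a) hp, w, ?_⟩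
      rw [smul_comm, hw, smul_add, pow_one, pow_succ, mul_smul]
  · intro z
    rw [mem_powColon_update hk]
    exact ⟨0, zero_mem _, x l • z, by rw [LinearMap.lsmul_apply, zero_add, smul_comm]⟩
  · intro z hz
    obtain ⟨p, hp, w, hw⟩ := (mem_powColon_update hk).mp hz
    rw [hw]
    refine Submodule.add_mem_sup ?_ ⟨w, rfl⟩
    rw [mem_powColon_update hk]
    exact ⟨_, Submodule.smul_mem _ (x l) hp, 0, by simp⟩

theorem nsmul_relLength_powColon_le (h : AnnihilatesColons x M (x l)) {ν : ι → ℕ}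
    (hν : ∀ i, ν i ≠ 0) {k : ι} (hk : k ≠ l) (hνk : ν k = 1) {a : ℕ} (ha : a ≠ 0) :
    a * relLength (powColon x M l ν ⊔ LinearMap.range (LinearMap.lsmul R M (x l))) ⊤ ≤
      relLength (powColon x M l (Function.update ν k a) ⊔
        LinearMap.range (LinearMap.lsmul R M (x l))) ⊤ := by
  have h1 : Function.update ν k 1 = ν := by rw [← hνk, Function.update_eq_self]
  induction a, Nat.one_le_iff_ne_zero.mpr ha using Nat.le_induction with
  | base => rw [h1, Nat.cast_one, one_mul]
  | succ a ha' ih =>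
    refine le_trans ?_ (relLength_powColon_add_le h hν hk (Nat.one_le_iff_ne_zero.mp ha'))
    rw [h1, Nat.cast_add, Nat.cast_one, add_mul, one_mul, add_comm]
    gcongr
    exact ih (Nat.one_le_iff_ne_zero.mp ha')

theorem pow_mul_relLength_powColon_le (h : AnnihilatesColons x M (x l)) {a : ℕ} (ha : a ≠ 0)
    (S : Finset ι) (hS : l ∉ S) :
    (a : ℕ∞) ^ S.card *
        relLength (powColon x M l 1 ⊔ LinearMap.range (LinearMap.lsmul R M (x l))) ⊤ ≤
      relLength (powColon x M l (fun i => if i ∈ S then a else 1) ⊔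
        LinearMap.range (LinearMap.lsmul R M (x l))) ⊤ := by
  induction S using Finset.induction_on with
  | empty => simp [Pi.one_def]
  | insert k S hk ih =>
    rw [Finset.mem_insert, not_or] at hS
    have h1 : (fun i => if i ∈ insert k S then a else 1) =
        Function.update (fun i => if i ∈ S then a else 1) k a := by
      ext i
      by_cases hi : i = k
      · subst hi; simp
      · simp [hi]
    rw [Finset.card_insert_of_notMem hk, pow_succ', mul_assoc, h1]
    refine le_trans ?_ (nsmul_relLength_powColon_le h (fun i => ?_) (Ne.symm hS.1)
      (by simp [hk]) ha)
    · gcongr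
      exact ih hS.2
    · split_ifs <;> simp [ha]

theorem pow_mul_relLength_le [Fintype ι] (h : AnnihilatesColons x M (x l)) {a : ℕ} (ha : a ≠ 0) :
    (a : ℕ∞) ^ Fintype.card ι *
        Module.length R (M ⧸ powColon x M l 1 ⊔ LinearMap.range (LinearMap.lsmul R M (x l))) ≤
      Module.length R (M ⧸ Ideal.span (Set.range fun i => x i ^ a) • (⊤ : Submodule R M)) := by
  have hc : Fintype.card ι = (Finset.univ.erase l).card + 1 := by
    rw [Finset.card_erase_add_one (Finset.mem_univ l), Finset.card_univ]
  have h1 := pow_mul_relLength_powColon_le h ha (Finset.univ.erase l) (by simp)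
  set ν : ι → ℕ := fun i => if i ∈ Finset.univ.erase l then a else 1
  have hν : ∀ i, ν i ≠ 0 := fun i => by
    simp only [ν]
    split_ifs <;> simp [ha]
  rw [← relLength_top, ← relLength_top, hc, pow_succ', mul_assoc]
  calc _ ≤ _ := mul_le_mul_right h1 _
    _ ≤ _ := nsmul_relLength_le_of_smul_saturated
        (fun z => mem_powColon_of_smul_mem h hν) a
    _ ≤ _ := by
      refine relLength_anti_left ?_ _
      rw [Submodule.smul_le]
      intro r hr z _
      refine Submodule.span_induction (p := fun r _ => r • z ∈ powColon x M l ν ⊔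
        LinearMap.range (LinearMap.lsmul R M (x l ^ a))) ?_ (by simp) ?_ ?_ hr
      · rintro _ ⟨i, rfl⟩
        by_cases hi : i = l
        · subst hi
          exact Submodule.mem_sup_right ⟨z, rfl⟩
        · refine Submodule.mem_sup_left ?_
          rw [mem_powColon, smul_comm]
          refine Submodule.smul_mem_smul (Ideal.subset_span ⟨i, hi, ?_⟩) trivial
          simp [ν, hi]
      · intro r r' _ _ hr hr'
        rw [add_smul]
        exact add_mem hr hr'
      · intro r r' _ hr'
        rw [smul_assoc]
        exact Submodule.smul_mem _ _ hr'

end PowColon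

section Counting

variable {σ : Type*} [Fintype σ]

theorem card_filter_not_le_le (S : Finset (σ →₀ ℕ)) (α₀ : σ →₀ ℕ) {c : ℕ}
    (h : ∀ i k, {α ∈ S | α i = k}.card ≤ c) :
    {α ∈ S | ¬ α₀ ≤ α}.card ≤ α₀.degree * c := by
  classical
  have hsub : {α ∈ S | ¬ α₀ ≤ α} ⊆
      Finset.univ.biUnion fun i => (Finset.range (α₀ i)).biUnion fun k => {α ∈ S | α i = k} := by
    intro α hα
    obtain ⟨hα, hle⟩ := Finset.mem_filter.mp hα
    obtain ⟨i, hi⟩ : ∃ i, α i < α₀ i := by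
      by_contra! h'
      exact hle h'
    simp only [Finset.mem_biUnion, Finset.mem_univ, true_and, Finset.mem_range]
    exact ⟨i, α i, hi, Finset.mem_filter.mpr ⟨hα, rfl⟩⟩
  refine (Finset.card_le_card hsub).trans (Finset.card_biUnion_le.trans ?_)
  rw [Finsupp.degree_eq_sum, Finset.sum_mul]
  refine Finset.sum_le_sum fun i _ => ?_
  simpa using Finset.card_biUnion_le_card_mul (Finset.range (α₀ i)) _ c fun k _ => h i k

theorem sum_le_card_mul_add (S : Finset (σ →₀ ℕ)) (α₀ : σ →₀ ℕ) {g : (σ →₀ ℕ) → ℕ∞} {c : ℕ}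
    {r b : ℕ∞} (h : ∀ i k, {α ∈ S | α i = k}.card ≤ c) (hr : ∀ α, α₀ ≤ α → g α ≤ r)
    (hb : ∀ α, g α ≤ b) :
    ∑ α ∈ S, g α ≤ S.card * r + (α₀.degree * c : ℕ) * b := by
  classical
  rw [← Finset.sum_filter_add_sum_filter_not S (fun α => α₀ ≤ α)]
  refine add_le_add ?_ ?_
  · refine (Finset.sum_le_card_nsmul _ _ r fun α hα => hr α (Finset.mem_filter.mp hα).2).trans ?_
    rw [nsmul_eq_mul]
    gcongr
    exact Finset.filter_subset _ _
  · refine (Finset.sum_le_card_nsmul _ _ b fun α _ => hb α).trans ?_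
    rw [nsmul_eq_mul]
    gcongr
    exact card_filter_not_le_le S α₀ h

theorem card_filter_finsupp_range_le [DecidableEq σ] (a : ℕ) (i : σ) (k : ℕ) :
    {α ∈ Finset.univ.finsupp (fun _ : σ => Finset.range a) | α i = k}.card ≤
      a ^ (Fintype.card σ - 1) := by
  have hsub : {α ∈ Finset.univ.finsupp (fun _ : σ => Finset.range a) | α i = k} ⊆
      Finset.univ.finsupp (Function.update (fun _ : σ => Finset.range a) i {k}) := by
    intro α hα
    obtain ⟨hα, hk⟩ := Finset.mem_filter.mp hα
    rw [Finset.mem_finsupp_iff] at hα ⊢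
    refine ⟨Finset.subset_univ _, fun j _ => ?_⟩
    by_cases hj : j = i
    · subst hj; simpa using hk
    · simpa [Function.update_of_ne hj] using hα.2 j (Finset.mem_univ j)
  refine (Finset.card_le_card hsub).trans ?_
  rw [Finset.card_finsupp, Finset.prod_eq_mul_prod_sdiff_singleton_of_mem (Finset.mem_univ i)]
  rw [Finset.prod_congr rfl (g := fun _ => a) fun j hj => ?_]
  · simp [Finset.card_sdiff]
  · have : j ≠ i := by simpa using hj
    simp [Function.update_of_ne this]

theorem card_filter_finsuppAntidiag_le [DecidableEq σ] (hσ : 2 ≤ Fintype.card σ) (n : ℕ) (i : σ)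
    (k : ℕ) :
    {α ∈ (Finset.univ : Finset σ).finsuppAntidiag n | α i = k}.card ≤
      (n + 1) ^ (Fintype.card σ - 2) := by
  obtain ⟨j, hj⟩ := Fintype.exists_ne_of_one_lt_card hσ i
  set F : σ → Finset ℕ := Function.update (Function.update (fun _ => Finset.range (n + 1)) i {k})
    j {0}
  have hmaps : ∀ α ∈ {α ∈ (Finset.univ : Finset σ).finsuppAntidiag n | α i = k},
      α.erase j ∈ Finset.univ.finsupp F := by
    intro α hα
    obtain ⟨hα, hk⟩ := Finset.mem_filter.mp hα
    rw [Finset.mem_finsuppAntidiag] at hα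
    rw [Finset.mem_finsupp_iff]
    refine ⟨Finset.subset_univ _, fun l _ => ?_⟩
    by_cases hlj : l = j
    · subst hlj; simp [F]
    by_cases hli : l = i
    · subst hli; simpa [F, Function.update_of_ne hlj, Finsupp.erase_ne hlj] using hk
    · have : α l ≤ n := by
        rw [← hα.1]
        exact Finset.single_le_sum (f := fun l => α l) (fun _ _ => Nat.zero_le _)
          (Finset.mem_univ l)
      simpa [F, Function.update_of_ne hlj, Function.update_of_ne hli, Finsupp.erase_ne hlj]
        using Nat.lt_succ_of_le this
  have hinj : Set.InjOn (fun α : σ →₀ ℕ => α.erase j)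
      ({α ∈ (Finset.univ : Finset σ).finsuppAntidiag n | α i = k} : Finset (σ →₀ ℕ)) := by
    intro α hα β hβ h
    have hα := (Finset.mem_finsuppAntidiag.mp (Finset.mem_filter.mp hα).1).1
    have hβ := (Finset.mem_finsuppAntidiag.mp (Finset.mem_filter.mp hβ).1).1
    have hne : ∀ l ≠ j, α l = β l := fun l hl => by
      simpa [Finsupp.erase_ne hl] using DFunLike.congr_fun h l
    rw [← hβ, ← Finset.add_sum_erase _ _ (Finset.mem_univ j),
      ← Finset.add_sum_erase _ (fun l => β l) (Finset.mem_univ j),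
      Finset.sum_congr rfl fun l hl => hne l (Finset.ne_of_mem_erase hl)] at hα
    ext l
    by_cases hl : l = j
    · subst hl; exact Nat.add_right_cancel hα
    · exact hne l hl
  refine (Finset.card_le_card_of_injOn _ hmaps hinj).trans ?_
  rw [Finset.card_finsupp, Finset.prod_eq_mul_prod_sdiff_singleton_of_mem (Finset.mem_univ j),
    Finset.prod_eq_mul_prod_sdiff_singleton_of_mem (i := i) (by simpa using hj.symm)]
  rw [Finset.prod_congr rfl (g := fun _ => n + 1) fun l hl => ?_]
  · have : ((Finset.univ \ {j}) \ {i}).card = Fintype.card σ - 2 := by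
      rw [Finset.card_sdiff_of_subset (by simpa using hj.symm), Finset.card_sdiff_of_subset
        (Finset.subset_univ _), Finset.card_univ]
      simp [Nat.sub_sub]
    rw [Finset.prod_const, this]
    simp [F, Function.update_of_ne hj.symm]
  · have hl : l ≠ j ∧ l ≠ i := by simpa using hl
    simp [F, Function.update_of_ne hl.1, Function.update_of_ne hl.2]

end Counting

section Asymptotics

theorem le_of_forall_pow_mul_le {L L' C m : ℕ}
    (h : ∀ a : ℕ, a ≠ 0 → a ^ (m + 1) * L ≤ a ^ (m + 1) * L' + C * a ^ m) : L ≤ L' := by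
  by_contra! hlt
  have h1 := h (C + 1) C.succ_ne_zero
  have h2 : (C + 1) * L ≤ (C + 1) * L' + C := by
    refine le_of_mul_le_mul_left (a := (C + 1) ^ m) ?_ (Nat.pow_pos C.succ_pos)
    calc _ = (C + 1) ^ (m + 1) * L := by ring
      _ ≤ _ := h1
      _ = _ := by ring
  nlinarith

theorem choose_add_le_pow (n k : ℕ) : (n + k).choose k ≤ (n + 1) ^ k := by
  induction k with
  | zero => simp
  | succ k ih =>
    have h1 : (k + 1) * (n + (k + 1)).choose (k + 1) = (n + k + 1) * (n + k).choose k := by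
      have := Nat.add_one_mul_choose_eq (n + k) k
      rw [mul_comm, ← add_assoc, ← this]
    refine le_of_mul_le_mul_left (a := k + 1) ?_ k.succ_pos
    rw [h1, pow_succ]
    calc (n + k + 1) * (n + k).choose k ≤ (n + k + 1) * (n + 1) ^ k := by gcongr
      _ ≤ ((k + 1) * (n + 1)) * (n + 1) ^ k := by gcongr; nlinarith
      _ = _ := by ring

theorem pow_le_factorial_mul_choose (n k : ℕ) : (n + 1) ^ k ≤ k.factorial * (n + k).choose k := by
  rw [← Nat.ascFactorial_eq_factorial_mul_choose]
  exact Nat.pow_succ_le_ascFactorial (n + 1) k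

theorem coeff_le_of_forall_sum_choose_le {m N C : ℕ} {r : ℤ} {f : ℕ → ℤ}
    (h : ∀ n ≥ N, ∑ i ∈ Finset.range (m + 2),
      (-1) ^ i * f i * ((n + (m + 2) - 1 - i).choose (m + 2 - 1 - i) : ℤ) ≤
        ((n + (m + 1)).choose (m + 1) : ℤ) * r + C * ((n + 1) ^ m : ℕ)) : f 0 ≤ r := by
  by_contra! hlt
  set D : ℕ := C + ∑ i ∈ Finset.range (m + 1), (f (i + 1)).natAbs
  have key : ∀ n ≥ N, ((n + (m + 1)).choose (m + 1) : ℤ) ≤ D * ((n + 1) ^ m : ℕ) := by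
    intro n hn
    have h1 := h n hn
    rw [Finset.sum_range_succ'] at h1
    have h2 : -∑ i ∈ Finset.range (m + 1), ((f (i + 1)).natAbs * ((n + 1) ^ m : ℕ) : ℤ) ≤
        ∑ i ∈ Finset.range (m + 1), (-1) ^ (i + 1) * f (i + 1) *
          ((n + (m + 2) - 1 - (i + 1)).choose (m + 2 - 1 - (i + 1)) : ℤ) := by
      rw [← Finset.sum_neg_distrib]
      refine Finset.sum_le_sum fun i hi => ?_
      have hi : i ≤ m := Nat.lt_succ_iff.mp (Finset.mem_range.mp hi)
      refine neg_le_of_abs_le ?_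
      rw [abs_mul, abs_mul, abs_pow, abs_neg, abs_one, one_pow, one_mul, Int.natCast_natAbs,
        Nat.abs_cast]
      gcongr
      have h3 : n + (m + 2) - 1 - (i + 1) = n + (m - i) := by omega
      have h4 : m + 2 - 1 - (i + 1) = m - i := by omega
      rw [h3, h4]
      exact (choose_add_le_pow _ _).trans (Nat.pow_le_pow_right n.succ_pos (Nat.sub_le m i))
    rw [← Finset.sum_mul] at h2
    have h5 : n + (m + 2) - 1 - 0 = n + (m + 1) := by omega
    have h6 : m + 2 - 1 - 0 = m + 1 := by omega
    rw [h5, h6, pow_zero, one_mul] at h1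
    have h7 : (0 : ℤ) ≤ ((n + (m + 1)).choose (m + 1) : ℤ) := by positivity
    have h8 : (D : ℤ) = C + ∑ i ∈ Finset.range (m + 1), ((f (i + 1)).natAbs : ℤ) := by
      simp only [D]
      push_cast
      rfl
    rw [h8, add_mul]
    nlinarith
  set n := N + (m + 1).factorial * D
  have h1 : (n + (m + 1)).choose (m + 1) ≤ D * (n + 1) ^ m := by
    exact_mod_cast key n (Nat.le_add_right _ _)
  have h2 : (n + 1) ^ m * (n + 1) ≤ (n + 1) ^ m * ((m + 1).factorial * D) := by
    calc (n + 1) ^ m * (n + 1) = (n + 1) ^ (m + 1) := (pow_succ _ _).symm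
      _ ≤ (m + 1).factorial * (n + (m + 1)).choose (m + 1) := pow_le_factorial_mul_choose n _
      _ ≤ (m + 1).factorial * (D * (n + 1) ^ m) := by gcongr
      _ = _ := by ring
  have h3 := Nat.le_of_mul_le_mul_left h2 (by positivity)
  omega

end Asymptotics

section StableColon

variable {R M : Type u} [CommRing R] [AddCommGroup M] [Module R M] [IsNoetherian R M]
  {σ : Type*} [Fintype σ] [LinearOrder σ] {x : σ → R} {l : σ}

theorem exists_forall_initColon_eq (hl : ∀ j, j ≤ l) (h : AnnihilatesColons x M (x l))
    (hfin : Module.length R (M ⧸ (Ideal.span (Set.range x) • (⊤ : Submodule R M))) ≠ ⊤) :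
    ∃ α₀, ∀ α, α₀ ≤ α →
      initColon x M α = powColon x M l 1 ⊔ LinearMap.range (LinearMap.lsmul R M (x l)) := by
  obtain ⟨α₁, hα₁⟩ := exists_initColon_eq x M
  refine ⟨α₁ + Finsupp.single l 1, fun α hα => (hα₁ α (le_self_add.trans hα)).trans ?_⟩
  set K := powColon x M l 1 ⊔ LinearMap.range (LinearMap.lsmul R M (x l))
  have hKle : K ≤ initColon x M α₁ := by
    rw [← hα₁ (α₁ + Finsupp.single l 1) le_self_add]
    refine sup_le (fun z hz => ?_) ?_
    · refine mem_initColon_of_smul_mem x M (l := l) (by simp) ?_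
      have : {j | j < l} = {j | j ≠ l} := by
        ext j
        exact (hl j).lt_iff_ne
      rw [this]
      simpa [mem_powColon] using hz
    · rintro _ ⟨z, rfl⟩
      exact smul_top_le_initColon x M _
        (Submodule.smul_mem_smul (Ideal.subset_span (Set.mem_range_self l)) trivial)
  have hlen : ∀ α, Module.length R (M ⧸ initColon x M α) ≤
      Module.length R (M ⧸ (Ideal.span (Set.range x) • (⊤ : Submodule R M))) := fun α => by
    rw [← relLength_top, ← relLength_top]
    exact relLength_anti_left (smul_top_le_initColon x M α) _
  have hK : Module.length R (M ⧸ K) ≤ Module.length R (M ⧸ initColon x M α₁) := by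
    have hbound : ∀ a : ℕ, a ≠ 0 → (a : ℕ∞) ^ Fintype.card σ * Module.length R (M ⧸ K) ≤
        (a ^ Fintype.card σ : ℕ) * Module.length R (M ⧸ initColon x M α₁) +
          (α₁.degree * a ^ (Fintype.card σ - 1) : ℕ) *
            Module.length R (M ⧸ (Ideal.span (Set.range x) • (⊤ : Submodule R M))) := by
      intro a ha
      refine (pow_mul_relLength_le h ha).trans ((length_quotient_pow_le x a).trans ?_)
      refine (sum_le_card_mul_add (r := Module.length R (M ⧸ initColon x M α₁)) _ α₁
        (card_filter_finsupp_range_le a) (fun α hα => by rw [hα₁ α hα]) hlen).trans ?_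
      simp [Finset.card_finsupp]
    obtain ⟨m, hm⟩ : ∃ m, Fintype.card σ = m + 1 :=
      Nat.exists_eq_succ_of_ne_zero (Fintype.card_pos_iff.mpr ⟨l⟩).ne'
    obtain ⟨b, hb⟩ := ENat.ne_top_iff_exists.mp hfin
    obtain ⟨L', hL'⟩ := ENat.ne_top_iff_exists.mp (ne_top_of_le_ne_top hfin (hlen α₁))
    have hKtop : Module.length R (M ⧸ K) ≠ ⊤ := by
      have := hbound 1 one_ne_zero
      rw [← hb, ← hL'] at this
      simp only [Nat.cast_one, one_pow, one_mul] at this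
      exact ne_top_of_le_ne_top (by norm_cast; exact ENat.natCast_ne_top _) this
    obtain ⟨L, hL⟩ := ENat.ne_top_iff_exists.mp hKtop
    rw [hm, ← hb, ← hL', ← hL, Nat.add_sub_cancel] at hbound
    rw [← hL', ← hL, Nat.cast_le]
    refine le_of_forall_pow_mul_le (C := α₁.degree * b) (m := m) fun a ha => ?_
    have := hbound a ha
    norm_cast at this
    rwa [mul_right_comm] at this
  refine le_antisymm ?_ hKle
  by_contra hnot
  have h1 := one_le_relLength hnot
  rw [← relLength_top, ← relLength_top, relLength_eq_add hKle le_top] at hK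
  obtain ⟨c, hc⟩ := ENat.ne_top_iff_exists.mp (ne_top_of_le_ne_top hfin (hlen α₁))
  rw [relLength_top, ← hc] at hK
  have h2 : 1 + (c : ℕ∞) ≤ c := le_trans (add_le_add_left h1 _) hK
  norm_cast at h2
  omega

theorem exists_relLength_pow_colon_le (hσ : 2 ≤ Fintype.card σ) (hl : ∀ j, j ≤ l)
    (h : AnnihilatesColons x M (x l))
    (hfin : Module.length R (M ⧸ (Ideal.span (Set.range x) • (⊤ : Submodule R M))) ≠ ⊤)
    {𝔪 : Ideal R} (hx : ∀ i, x i ∈ 𝔪) :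
    ∃ C : ℕ, ∀ n, relLength (Ideal.span (Set.range x) ^ (n + 1) • (⊤ : Submodule R M))
        (modColon R (Ideal.span (Set.range x) ^ (n + 1) • (⊤ : Submodule R M)) 𝔪) ≤
      ((Fintype.card σ + n - 1).choose n : ℕ) *
        relLength (powColon x M l 1 ⊔ LinearMap.range (LinearMap.lsmul R M (x l)))
          (modColon R (powColon x M l 1 ⊔ LinearMap.range (LinearMap.lsmul R M (x l))) 𝔪) +
      (C * (n + 1) ^ (Fintype.card σ - 2) : ℕ) := by
  obtain ⟨α₀, hα₀⟩ := exists_forall_initColon_eq hl h hfin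
  set K := powColon x M l 1 ⊔ LinearMap.range (LinearMap.lsmul R M (x l))
  obtain ⟨b, hb⟩ := ENat.ne_top_iff_exists.mp hfin
  set B := (finite_initColon_ne x M).toFinset
  refine ⟨B.card * b + α₀.degree * b, fun n => ?_⟩
  refine (relLength_pow_colon_le x 𝔪 hx n B fun α hα => by simpa [B] using hα).trans ?_
  have hsum := sum_le_card_mul_add (Finset.univ.finsuppAntidiag n) α₀
    (g := fun α => relLength (initColon x M α) (modColon R (initColon x M α) 𝔪))
    (r := relLength K (modColon R K 𝔪)) (b := b)
    (card_filter_finsuppAntidiag_le hσ n) (fun α hα => by rw [hα₀ α hα]) fun α => by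
      rw [hb, ← relLength_top]
      exact (relLength_mono_right _ le_top).trans
        (relLength_anti_left (smul_top_le_initColon x M α) _)
  rw [Finset.card_finsuppAntidiag_nat_eq_choose, Finset.card_univ] at hsum
  rw [← hb]
  refine (add_le_add_right hsum _).trans ?_
  rw [add_left_comm]
  refine add_le_add_right ?_ _
  norm_cast
  have h1 : 1 ≤ (n + 1) ^ (Fintype.card σ - 2) := Nat.one_le_pow _ _ n.succ_pos
  nlinarith [Nat.zero_le (B.card * b)]

end StableColon

section StableValue

variable {R : Type u} [CommRing R] [IsLocalRing R] {M : Type u} [AddCommGroup M] [Module R M]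

theorem irMod_eq_relLength (q : Ideal R) : irMod R M q =
    (relLength (q • (⊤ : Submodule R M)) (modColon R (q • ⊤) (maximalIdeal R)) : ℕ∞) := by
  rw [irMod, moduleLength, relLength, Module.coe_length]

theorem IsIrrCoeffMod.coeff_zero_le [IsNoetherian R M] {m : ℕ} {x : Fin (m + 2) → R}
    {f : ℕ → ℤ} (hf : IsIrrCoeffMod R (Ideal.span (Set.range x)) M (m + 2) f) (hx : IsSOP R M x)
    (h : AnnihilatesColons x M (x (Fin.last (m + 1)))) {r : ℕ}
    (hr : relLength (powColon x M (Fin.last (m + 1)) 1 ⊔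
        LinearMap.range (LinearMap.lsmul R M (x (Fin.last (m + 1)))))
      (modColon R (powColon x M (Fin.last (m + 1)) 1 ⊔
        LinearMap.range (LinearMap.lsmul R M (x (Fin.last (m + 1))))) (maximalIdeal R)) ≤ r) :
    f 0 ≤ r := by
  obtain ⟨C, hC⟩ := exists_relLength_pow_colon_le (𝔪 := maximalIdeal R) (by simp) Fin.le_last h
    (Module.length_ne_top_iff.mpr hx.2.2) hx.2.1
  obtain ⟨N, hN⟩ := hf
  refine coeff_le_of_forall_sum_choose_le (N := N) (C := C) (m := m) fun n hn => ?_
  obtain ⟨L, hL, hLf⟩ := hN n hn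
  rw [irMod_eq_relLength] at hL
  have hL' : relLength (Ideal.span (Set.range x) ^ (n + 1) • (⊤ : Submodule R M))
      (modColon R (Ideal.span (Set.range x) ^ (n + 1) • ⊤) (maximalIdeal R)) = (L : ℕ∞) :=
    WithBot.coe_injective hL
  have h1 := (hC n).trans (add_le_add_left (mul_le_mul_right hr _) _)
  rw [hL', Fintype.card_fin] at h1
  norm_cast at h1
  have h2 : (m + 2 + n - 1).choose n = (n + (m + 1)).choose (m + 1) := by
    rw [show m + 2 + n - 1 = n + (m + 1) by omega]
    exact Nat.choose_symm_add
  rw [h2, show m + 1 + 1 - 2 = m from rfl] at h1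
  rw [← hLf]
  exact_mod_cast h1

end StableValue

/-- If `M` is unmixed of dimension at least `2` and `𝒩(M) ≤ f_0(q, M)` for some
C-parameter ideal `q` of `M`, then `M` is Cohen-Macaulay. -/
theorem statement_1 {R : Type u} [CommRing R] [IsLocalRing R] [IsNoetherianRing R]
    (hres : IsHomImageOfCM R) (hdim0 : 0 < ringKrullDim R)
    (M : Type u) [AddCommGroup M] [Module R M] [Module.Finite R M]
    (hum : IsUnmixedMod R M) (hdim : (2 : WithBot ℕ∞) ≤ moduleDim R M)
    {s : ℕ} (x : Fin s → R) (hx : IsCSOP R M x)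
    (NM : ℕ) (hNM : IsStableValueMod R M NM)
    (f : ℕ → ℤ) (hf : IsIrrCoeffMod R (Ideal.span (Set.range x)) M s f)
    (hle : (NM : ℤ) ≤ f 0) :
    IsCMMod R M := by
  have hs : 2 ≤ s := by
    rw [hx.1.1] at hdim
    exact_mod_cast hdim
  obtain ⟨m, rfl⟩ := Nat.exists_eq_add_of_le' hs
  set y := x (Fin.last (m + 1)) with hy
  have hy3 : y ∈ bIdeal R M ^ 3 := hx.last_mem_bIdeal
  have hyb : y ∈ bIdeal R M * bIdeal R M := by
    rw [← pow_two]
    exact Ideal.pow_le_pow_right (by norm_num) hy3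
  have hkill : ∀ c ∈ bIdeal R M, AnnihilatesColons x M c :=
    fun c hc n hn T i hi z hz => smul_mem_of_mem_bIdeal hx.1 hc n hn hi hz
  have hkilly := hkill y (Ideal.mul_le_right hyb)
  set P := Ideal.span (x '' {j | j ≠ Fin.last (m + 1)}) • (⊤ : Submodule R M) with hP
  have hset : {j : Fin (m + 2) | j.val < m + 1} = {j | j ≠ Fin.last (m + 1)} := by
    ext j
    exact Fin.lt_last_iff_ne_last
  refine isCMMod_of_last_smul_mem hx.1.2.1 hkilly ?_ hx.1.1
  rw [hset]
  by_contra! hne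
  obtain ⟨h, hyh, hh⟩ := hne
  have hQ : Ideal.span (Set.range x) • (⊤ : Submodule R M) =
      P ⊔ LinearMap.range (LinearMap.lsmul R M y) := by
    have h1 : Set.range x = x '' {j | j ≠ Fin.last (m + 1)} ∪ {y} := by
      rw [hy, ← Set.image_singleton, ← Set.image_union, ← Set.image_univ]
      congr 1
      ext j
      simp [em]
    rw [h1, Ideal.span_union, Submodule.sup_smul, Submodule.ideal_span_singleton_smul]
    congr 1
    ext z
    simp [Submodule.mem_smul_pointwise_iff_exists]
  have hK : powColon x M (Fin.last (m + 1)) 1 = P.comap (LinearMap.lsmul R M y) := by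
    simp [powColon, hP, hy]
  have hN : relLength (P ⊔ LinearMap.range (LinearMap.lsmul R M y))
      (modColon R (P ⊔ LinearMap.range (LinearMap.lsmul R M y)) (maximalIdeal R)) = (NM : ℕ∞) := by
    rw [← hQ]
    exact WithBot.coe_injective ((irMod_eq_relLength _).symm.trans (hNM _ ⟨_, x, hx, rfl⟩))
  have hlt := relLength_modColon_add_one_le (P := P)
    (fun c hc k hk z hz => (hkill c hc).smul_mem (by simp) hk hz) hyb
    (by rw [← hQ]; exact hx.1.2.2) hyh hh
  rw [hN, ← hK] at hlt
  obtain ⟨r, hr⟩ := ENat.ne_top_iff_exists.mp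
    (ne_top_of_le_ne_top (ENat.natCast_ne_top NM) (le_self_add.trans hlt))
  rw [← hr] at hlt
  have h1 := hf.coeff_zero_le hx.1 hkilly hr.ge
  norm_cast at hlt
  omega
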